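/- arXiv:1802.01184 — 7 statements merged into one kernel-verified Lean document; each statement's English description precedes it below -/
import Mathlib

section
/- For every integer q ≥ 2 and every real δ with 0 < δ < 1/q there exists a constant c = c(q,δ) > 0 such that for every n ≥ 1 and every q-locally correctable code C ⊆ F₂ⁿ with density δ, the covering radius of the dual code C^⊥ is at most c·n^{(q−2)/(q−1)}. -/
/-- The dual of a set of vectors in `F₂ⁿ`: all vectors orthogonal to every element. -/
def dualSet {n : ℕ} (V : Set (Fin n → ZMod 2)) : Set (Fin n → ZMod 2) :=
  {y | ∀ x ∈ V, ∑ i, x i * y i = 0}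

/-- `C` is a `q`-locally correctable code with density `δ`: for every coordinate `i`,
either `eᵢ ∈ C^⊥`, or `C^⊥` contains at least `δn` vectors of Hamming weight `q+1`
whose supports all contain `i` and are pairwise disjoint outside of `i`. -/
def IsLocallyCorrectable (n q : ℕ) (δ : ℝ) (C : Submodule (ZMod 2) (Fin n → ZMod 2)) : Prop :=
  ∀ i : Fin n,
    (Pi.single i 1 ∈ dualSet (C : Set (Fin n → ZMod 2))) ∨
    ∃ F : Finset (Fin n → ZMod 2),
      δ * n ≤ (F.card : ℝ) ∧
      (∀ y ∈ F, y ∈ dualSet (C : Set (Fin n → ZMod 2)) ∧ hammingNorm y = q + 1 ∧ y i ≠ 0) ∧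
      (∀ y ∈ F, ∀ z ∈ F, y ≠ z → ∀ j : Fin n, j ≠ i → ¬(y j ≠ 0 ∧ z j ≠ 0))

namespace LCCproof

open Finset

/-- one-coordinate Bernoulli weight -/
noncomputable def bw (p : ℝ) (v : ZMod 2) : ℝ := if v = 0 then 1 - p else p

/-- expectation with respect to the product Bernoulli measure -/
noncomputable def EE {n : ℕ} (p : ℝ) (Y : (Fin n → ZMod 2) → ℝ) : ℝ :=
  ∑ T : Fin n → ZMod 2, (∏ i, bw p (T i)) * Y T

lemma zmod2_cases (v : ZMod 2) : v = 0 ∨ v = 1 := by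
  revert v; decide

lemma bw_nonneg {p : ℝ} (h0 : 0 ≤ p) (h1 : p ≤ 1) (v : ZMod 2) : 0 ≤ bw p v := by
  unfold bw; split_ifs <;> linarith

lemma EE_one {n : ℕ} (p : ℝ) : EE (n := n) p (fun _ => 1) = 1 := by
  unfold EE
  simp only [mul_one]
  have h := Finset.prod_univ_sum (fun _ : Fin n => (Finset.univ : Finset (ZMod 2)))
    (fun _ v => bw p v)
  rw [Fintype.piFinset_univ] at h
  rw [← h]
  apply Finset.prod_eq_one
  intro i _
  have : (Finset.univ : Finset (ZMod 2)) = {0, 1} := by decide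
  rw [this, Finset.sum_pair (by decide)]
  simp [bw]

lemma EE_add {n : ℕ} (p : ℝ) (X Y : (Fin n → ZMod 2) → ℝ) :
    EE p (fun T => X T + Y T) = EE p X + EE p Y := by
  simp [EE, mul_add, Finset.sum_add_distrib]

lemma EE_sub {n : ℕ} (p : ℝ) (X Y : (Fin n → ZMod 2) → ℝ) :
    EE p (fun T => X T - Y T) = EE p X - EE p Y := by
  simp [EE, mul_sub, Finset.sum_sub_distrib]

lemma EE_smul {n : ℕ} (p c : ℝ) (X : (Fin n → ZMod 2) → ℝ) :
    EE p (fun T => c * X T) = c * EE p X := by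
  simp only [EE, Finset.mul_sum]
  exact Finset.sum_congr rfl fun _ _ => by ring

lemma EE_sum {n : ℕ} {ι : Type*} (p : ℝ) (s : Finset ι) (X : ι → (Fin n → ZMod 2) → ℝ) :
    EE p (fun T => ∑ k ∈ s, X k T) = ∑ k ∈ s, EE p (X k) := by
  simp only [EE, Finset.mul_sum]
  exact Finset.sum_comm

lemma EE_mono {n : ℕ} {p : ℝ} (h0 : 0 ≤ p) (h1 : p ≤ 1) {X Y : (Fin n → ZMod 2) → ℝ}
    (h : ∀ T, X T ≤ Y T) : EE p X ≤ EE p Y :=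
  Finset.sum_le_sum fun T _ =>
    mul_le_mul_of_nonneg_left (h T) (Finset.prod_nonneg fun i _ => bw_nonneg h0 h1 _)

lemma EE_single {n : ℕ} (p : ℝ) (j : Fin n) (v : ZMod 2) (Y : (Fin n → ZMod 2) → ℝ) :
    EE p (fun T => (if T j = v then 1 else 0) * Y T)
      = bw p v * EE p (fun T => Y (Function.update T j v)) := by
  unfold EE
  let u : (Fin n → ZMod 2) → ℝ := fun T => ∏ i ∈ Finset.univ.erase j, bw p (T i)
  have hu : ∀ T : Fin n → ZMod 2, ∏ i, bw p (T i) = bw p (T j) * u T := fun T =>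
    (Finset.mul_prod_erase _ _ (Finset.mem_univ j)).symm
  have huu : ∀ (T : Fin n → ZMod 2) w, u (Function.update T j w) = u T := by
    intro T w
    apply Finset.prod_congr rfl
    intro i hi
    rw [Function.update_of_ne (Finset.ne_of_mem_erase hi)]
  have key : ∀ w w' : ZMod 2, ∀ G : (Fin n → ZMod 2) → ℝ,
      ∑ T, (if T j = w then G (Function.update T j v) else 0)
       = ∑ T, (if T j = w' then G (Function.update T j v) else 0) := by
    intro w w' G
    let e : (Fin n → ZMod 2) ≃ (Fin n → ZMod 2) := Equiv.addRight (Pi.single j (w - w'))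
    rw [← e.sum_comp]
    apply Finset.sum_congr rfl
    intro T _
    have h1 : e T j = T j + (w - w') := by simp [e]
    have h2 : Function.update (e T) j v = Function.update T j v := by
      funext i
      by_cases h : i = j
      · subst h; simp
      · simp [e, h]
    rw [h1, h2]
    have : (T j + (w - w') = w) ↔ T j = w' := by
      constructor
      · intro h; linear_combination h
      · intro h; rw [h]; ring
    simp only [this]
  have L : ∑ T : Fin n → ZMod 2, (∏ i, bw p (T i)) * ((if T j = v then 1 else 0) * Y T)
      = bw p v * ∑ T : Fin n → ZMod 2,
        (if T j = v then (fun S => u S * Y S) (Function.update T j v) else 0) := by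
    rw [Finset.mul_sum]
    apply Finset.sum_congr rfl
    intro T _
    split_ifs with h
    · have : Function.update T j v = T := by rw [← h]; simp
      simp only [this, hu, h]; ring
    · simp
  have R : ∑ T : Fin n → ZMod 2, (∏ i, bw p (T i)) * Y (Function.update T j v)
      = ∑ w : ZMod 2, bw p w * ∑ T : Fin n → ZMod 2,
        (if T j = w then (fun S => u S * Y S) (Function.update T j v) else 0) := by
    simp only [Finset.mul_sum]
    rw [Finset.sum_comm]
    apply Finset.sum_congr rfl
    intro T _
    simp [hu, huu, mul_assoc]
  rw [L, R]
  congr 1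
  simp only [fun w => key w v (fun S => u S * Y S)]
  rw [← Finset.sum_mul]
  have : (Finset.univ : Finset (ZMod 2)) = {0, 1} := by decide
  rw [this, Finset.sum_pair (by decide)]
  simp [bw]

/-- indicator that `T` agrees with `B` on `A` -/
noncomputable def ind {n : ℕ} (A : Finset (Fin n)) (B T : Fin n → ZMod 2) : ℝ :=
  ∏ j ∈ A, if T j = B j then 1 else 0

lemma ind_eq {n : ℕ} (A : Finset (Fin n)) (B T : Fin n → ZMod 2) :
    ind A B T = if ∀ j ∈ A, T j = B j then 1 else 0 := by
  unfold ind
  exact Finset.prod_ite_zero.trans (by simp)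

lemma ind_congr {n : ℕ} (A : Finset (Fin n)) (B T T' : Fin n → ZMod 2)
    (h : ∀ j ∈ A, T j = T' j) : ind A B T = ind A B T' :=
  Finset.prod_congr rfl fun j hj => by rw [h j hj]

lemma EE_block {n : ℕ} (p : ℝ) (A : Finset (Fin n)) (B : Fin n → ZMod 2)
    (Y : (Fin n → ZMod 2) → ℝ) :
    EE p (fun T => ind A B T * Y T)
      = (∏ j ∈ A, bw p (B j)) * EE p (fun T => Y (A.piecewise B T)) := by
  classical
  induction A using Finset.induction_on generalizing Y with
  | empty => simp [ind]
  | insert a s ha ih =>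
    have h1 : (fun T => ind (insert a s) B T * Y T)
        = fun T => (if T a = B a then 1 else 0) * (ind s B T * Y T) := by
      funext T
      simp only [ind, Finset.prod_insert ha]; ring
    rw [h1, EE_single, Finset.prod_insert ha]
    have h2 : (fun T => ind s B (Function.update T a (B a)) * Y (Function.update T a (B a)))
        = fun T => ind s B T * Y (Function.update T a (B a)) := by
      funext T
      rw [ind_congr s B _ T]
      intro j hj
      rw [Function.update_of_ne]
      rintro rfl; exact ha hj
    rw [h2, ih, mul_assoc]
    congr 3
    funext T
    rw [Finset.piecewise_insert]

/-- block acceptance function -/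
noncomputable def acc {n : ℕ} (p : ℝ) (q : ℕ) (A : Finset (Fin n)) (b : Fin n)
    (T : Fin n → ZMod 2) : ℝ :=
  p ^ (q - 2) * ind A (Pi.single b 1) T + (1 - p) ^ (q - 2) * ind A (Pi.single b 1 + 1) T

lemma prod_B {n q : ℕ} (hq : 2 ≤ q) (p : ℝ) (A : Finset (Fin n)) (b : Fin n) (hb : b ∈ A)
    (hA : A.card = q) :
    ∏ j ∈ A, bw p ((Pi.single b 1 : Fin n → ZMod 2) j) = p * (1 - p) ^ (q - 1) := by
  rw [← Finset.mul_prod_erase _ _ hb]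
  congr 1
  · simp [bw]
  · rw [Finset.prod_congr rfl (g := fun _ => (1 - p)), Finset.prod_const,
      Finset.card_erase_of_mem hb, hA]
    intro j hj
    simp [bw, Finset.ne_of_mem_erase hj]

lemma prod_B' {n q : ℕ} (hq : 2 ≤ q) (p : ℝ) (A : Finset (Fin n)) (b : Fin n) (hb : b ∈ A)
    (hA : A.card = q) :
    ∏ j ∈ A, bw p ((Pi.single b 1 + 1 : Fin n → ZMod 2) j) = (1 - p) * p ^ (q - 1) := by
  rw [← Finset.mul_prod_erase _ _ hb]
  congr 1
  · have : (1 : ZMod 2) + 1 = 0 := by decide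
    simp [bw, this]
  · rw [Finset.prod_congr rfl (g := fun _ => p), Finset.prod_const,
      Finset.card_erase_of_mem hb, hA]
    intro j hj
    simp [bw, Finset.ne_of_mem_erase hj]

lemma acc_mem {n q : ℕ} {p : ℝ} (h0 : 0 ≤ p) (h1 : p ≤ 1) (A : Finset (Fin n)) (b : Fin n)
    (hb : b ∈ A) (T : Fin n → ZMod 2) : 0 ≤ acc p q A b T ∧ acc p q A b T ≤ 1 := by
  unfold acc
  rw [ind_eq, ind_eq]
  have e1 : p ^ (q - 2) ≤ 1 := pow_le_one₀ h0 h1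
  have e2 : (1 - p) ^ (q - 2) ≤ 1 := pow_le_one₀ (by linarith) (by linarith)
  have e3 : 0 ≤ p ^ (q - 2) := by positivity
  have e4 : 0 ≤ (1 - p) ^ (q - 2) := pow_nonneg (by linarith) _
  split_ifs with ha hc
  · exfalso
    have := (ha b hb).symm.trans (hc b hb)
    simp at this
  all_goals constructor <;> linarith

lemma EE_acc_indep {n q : ℕ} (hq : 2 ≤ q) (p : ℝ) (A : Finset (Fin n)) (b : Fin n)
    (hb : b ∈ A) (hA : A.card = q) (X : (Fin n → ZMod 2) → ℝ)
    (hX : ∀ B T, X (A.piecewise B T) = X T) :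
    EE p (fun T => acc p q A b T * X T) = 2 * (p * (1 - p)) ^ (q - 1) * EE p X := by
  have h : (fun T => acc p q A b T * X T) = fun T =>
      p ^ (q - 2) * (ind A (Pi.single b 1) T * X T)
        + (1 - p) ^ (q - 2) * (ind A (Pi.single b 1 + 1) T * X T) := by
    funext T; unfold acc; ring
  rw [h, EE_add, EE_smul, EE_smul, EE_block, EE_block, prod_B hq p A b hb hA,
    prod_B' hq p A b hb hA]
  simp only [hX]
  obtain ⟨k, rfl⟩ := Nat.exists_eq_add_of_le hq
  have e1 : 2 + k - 2 = k := by omega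
  have e2 : 2 + k - 1 = k + 1 := by omega
  have e3 : EE p (fun T => X T) = EE p X := rfl
  rw [e1, e2, e3, mul_pow]
  ring

lemma EE_acc_anti {n q : ℕ} (hq : 2 ≤ q) (p : ℝ) (A : Finset (Fin n)) (b : Fin n)
    (hb : b ∈ A) (hA : A.card = q) (Y : (Fin n → ZMod 2) → ℝ)
    (hY : ∀ T, Y (A.piecewise (T + 1) T) = - Y T) :
    EE p (fun T => acc p q A b T * Y T) = 0 := by
  have h : (fun T => acc p q A b T * Y T) = fun T =>
      p ^ (q - 2) * (ind A (Pi.single b 1) T * Y T)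
        + (1 - p) ^ (q - 2) * (ind A (Pi.single b 1 + 1) T * Y T) := by
    funext T; unfold acc; ring
  rw [h, EE_add, EE_smul, EE_smul, EE_block, EE_block, prod_B hq p A b hb hA,
    prod_B' hq p A b hb hA]
  have h2 : (fun T => Y (A.piecewise (Pi.single b 1 + 1) T))
      = fun T => (-1) * Y (A.piecewise (Pi.single b 1) T) := by
    funext T
    rw [neg_one_mul, ← hY]
    congr 1
    funext j
    by_cases hj : j ∈ A <;> simp [Finset.piecewise, hj]
  rw [h2, EE_smul]
  obtain ⟨k, rfl⟩ := Nat.exists_eq_add_of_le hq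
  have e1 : 2 + k - 2 = k := by omega
  have e2 : 2 + k - 1 = k + 1 := by omega
  rw [e1, e2]
  ring

lemma acc_congr {n q : ℕ} (p : ℝ) (A : Finset (Fin n)) (b : Fin n) (T T' : Fin n → ZMod 2)
    (h : ∀ j ∈ A, T j = T' j) : acc p q A b T = acc p q A b T' := by
  unfold acc
  rw [ind_congr A _ T T' h, ind_congr A _ T T' h]

/-- main contraction lemma -/
lemma EE_anti_bound {n q : ℕ} {ι : Type*} (hq : 2 ≤ q) {p : ℝ} (h0 : 0 ≤ p) (h1 : p ≤ 1)
    (K : Finset ι) (A : ι → Finset (Fin n)) (b : ι → Fin n)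
    (hb : ∀ k ∈ K, b k ∈ A k) (hA : ∀ k ∈ K, (A k).card = q)
    (hdis : ∀ k ∈ K, ∀ l ∈ K, k ≠ l → Disjoint (A k) (A l))
    (D : (Fin n → ZMod 2) → ℝ) (hD : ∀ T, |D T| ≤ 1)
    (hanti : ∀ k ∈ K, ∀ T, D ((A k).piecewise (T + 1) T) = - D T) :
    |EE p D| ≤ (1 - 2 * (p * (1 - p)) ^ (q - 1)) ^ K.card := by
  classical
  have inv : ∀ L ⊆ K, ∀ k ∈ K, k ∉ L → ∀ B T,
      ∏ l ∈ L, (1 - acc p q (A l) (b l) ((A k).piecewise B T))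
        = ∏ l ∈ L, (1 - acc p q (A l) (b l) T) := by
    intro L hL k hk hkL B T
    apply Finset.prod_congr rfl
    intro l hl
    rw [acc_congr p (A l) (b l) _ T]
    intro j hj
    apply Finset.piecewise_eq_of_notMem
    intro hjk
    exact Finset.disjoint_left.1 (hdis k hk l (hL hl) (by rintro rfl; exact hkL hl)) hjk hj
  have s1 : ∀ L ⊆ K, EE p D = EE p (fun T => (∏ l ∈ L, (1 - acc p q (A l) (b l) T)) * D T) := by
    intro L
    induction L using Finset.induction_on with
    | empty => intro _; simp
    | insert k L hk ih =>
      intro hL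
      have hkK := hL (Finset.mem_insert_self k L)
      have hLK : L ⊆ K := fun x hx => hL (Finset.mem_insert_of_mem hx)
      rw [ih hLK]
      have : (fun T => (∏ l ∈ insert k L, (1 - acc p q (A l) (b l) T)) * D T)
        = fun T => (∏ l ∈ L, (1 - acc p q (A l) (b l) T)) * D T
          - acc p q (A k) (b k) T * ((∏ l ∈ L, (1 - acc p q (A l) (b l) T)) * D T) := by
        funext T
        rw [Finset.prod_insert hk]; ring
      rw [this, EE_sub, EE_acc_anti hq p (A k) (b k) (hb k hkK) (hA k hkK), sub_zero]
      intro T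
      rw [inv L hLK k hkK hk, hanti k hkK]; ring
  have s2 : ∀ L ⊆ K, EE p (fun T => ∏ l ∈ L, (1 - acc p q (A l) (b l) T))
      = (1 - 2 * (p * (1 - p)) ^ (q - 1)) ^ L.card := by
    intro L
    induction L using Finset.induction_on with
    | empty => intro _; simpa using EE_one p
    | insert k L hk ih =>
      intro hL
      have hkK := hL (Finset.mem_insert_self k L)
      have hLK : L ⊆ K := fun x hx => hL (Finset.mem_insert_of_mem hx)
      have : (fun T => (∏ l ∈ insert k L, (1 - acc p q (A l) (b l) T)))
        = fun T => (∏ l ∈ L, (1 - acc p q (A l) (b l) T))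
          - acc p q (A k) (b k) T * ((∏ l ∈ L, (1 - acc p q (A l) (b l) T))) := by
        funext T
        rw [Finset.prod_insert hk]; ring
      rw [this, EE_sub, EE_acc_indep hq p (A k) (b k) (hb k hkK) (hA k hkK) _
        (inv L hLK k hkK hk), ih hLK, Finset.card_insert_of_notMem hk]
      ring
  rw [← s2 K subset_rfl, s1 K subset_rfl]
  have hpos : ∀ T, 0 ≤ ∏ l ∈ K, (1 - acc p q (A l) (b l) T) := fun T =>
    Finset.prod_nonneg fun l hl => by
      have := (acc_mem (q := q) h0 h1 (A l) (b l) (hb l hl) T).2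
      linarith
  rw [abs_le]
  constructor
  · have : - EE p (fun T => ∏ l ∈ K, (1 - acc p q (A l) (b l) T))
      = EE p (fun T => (-1) * ∏ l ∈ K, (1 - acc p q (A l) (b l) T)) := by
      rw [EE_smul]; ring
    rw [this]
    apply EE_mono h0 h1
    intro T
    nlinarith [hpos T, (abs_le.1 (hD T)).1]
  · apply EE_mono h0 h1
    intro T
    nlinarith [hpos T, (abs_le.1 (hD T)).2]

lemma EE_norm {n : ℕ} (p : ℝ) :
    EE (n := n) p (fun T => (hammingNorm T : ℝ)) = p * n := by
  have : (fun T : Fin n → ZMod 2 => (hammingNorm T : ℝ))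
      = fun T => ∑ j ∈ Finset.univ, (if T j = 1 then 1 else 0) * (1 : ℝ) := by
    funext T
    simp only [hammingNorm, mul_one]
    rw [Finset.sum_boole]
    congr 2
    ext j
    rcases zmod2_cases (T j) with h | h <;> simp [h]
  rw [this, EE_sum]
  have h : ∀ j : Fin n, EE p (fun T : Fin n → ZMod 2 => (if T j = 1 then 1 else 0) * (1 : ℝ)) = p := by
    intro j
    rw [EE_single p j 1 (fun _ => 1), EE_one]; simp [bw]
  rw [Finset.sum_congr rfl (fun j _ => h j)]
  simp [mul_comm]

/-- coset weight -/
noncomputable def cw {n : ℕ} (V : Set (Fin n → ZMod 2)) (z : Fin n → ZMod 2) : ℕ :=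
  sInf {k | ∃ y ∈ V, hammingDist z y = k}

lemma cw_spec {n : ℕ} {V : Set (Fin n → ZMod 2)} (h0 : 0 ∈ V) (z : Fin n → ZMod 2) :
    ∃ y ∈ V, hammingDist z y = cw V z :=
  Nat.sInf_mem (s := {k | ∃ y ∈ V, hammingDist z y = k}) ⟨_, 0, h0, rfl⟩

lemma cw_le {n : ℕ} {V : Set (Fin n → ZMod 2)} (z y : Fin n → ZMod 2) (hy : y ∈ V) :
    cw V z ≤ hammingDist z y :=
  Nat.sInf_le ⟨y, hy, rfl⟩

lemma add_self' {n : ℕ} (z : Fin n → ZMod 2) : z + z = 0 := by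
  funext i
  have : ∀ v : ZMod 2, v + v = 0 := by decide
  exact this _

lemma dist_eq {n : ℕ} (x y : Fin n → ZMod 2) : hammingDist x y = hammingNorm (x + y) := by
  unfold hammingDist hammingNorm
  congr 1
  ext j
  have : ∀ u v : ZMod 2, u ≠ v ↔ u + v ≠ 0 := by decide
  simpa using not_congr (not_iff_not.1 (this (x j) (y j)))

lemma cw_add_le {n : ℕ} {V : Set (Fin n → ZMod 2)} (h0 : 0 ∈ V) (z t : Fin n → ZMod 2) :
    cw V (z + t) ≤ cw V z + hammingNorm t := by
  obtain ⟨y, hy, h⟩ := cw_spec h0 z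
  calc cw V (z + t) ≤ hammingDist (z + t) y := cw_le _ _ hy
    _ ≤ hammingDist (z + t) z + hammingDist z y := hammingDist_triangle _ _ _
    _ = cw V z + hammingNorm t := by rw [h, dist_eq, add_right_comm, add_self', zero_add, add_comm]

lemma cw_add_mem {n : ℕ} {V : Set (Fin n → ZMod 2)} (h0 : 0 ∈ V)
    (hadd : ∀ x ∈ V, ∀ y ∈ V, x + y ∈ V) (z d : Fin n → ZMod 2) (hd : d ∈ V) :
    cw V (z + d) = cw V z := by
  have key : ∀ z, cw V (z + d) ≤ cw V z := by
    intro z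
    obtain ⟨y, hy, h⟩ := cw_spec h0 z
    rw [← h]
    refine (cw_le _ (y + d) (hadd _ hy _ hd)).trans ?_
    have e : z + d + (y + d) = z + y + (d + d) := by abel
    rw [dist_eq, dist_eq, e, add_self', add_zero]
  apply le_antisymm (key z)
  have := key (z + d)
  rwa [add_assoc, add_self', add_zero] at this

lemma norm_single {n : ℕ} (i : Fin n) : hammingNorm (Pi.single i 1 : Fin n → ZMod 2) ≤ 1 := by
  unfold hammingNorm
  rw [Finset.card_le_one]
  intro a ha b hb
  simp [Pi.single_apply] at ha hb
  rw [ha, hb]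

lemma diff_bound {n q : ℕ} (hq : 2 ≤ q) {δ p : ℝ} (h0 : 0 ≤ p) (h1 : p ≤ 1)
    (C : Submodule (ZMod 2) (Fin n → ZMod 2)) (hC : IsLocallyCorrectable n q δ C)
    (V : Set (Fin n → ZMod 2)) (hV : V = dualSet (C : Set (Fin n → ZMod 2)))
    (hV0 : 0 ∈ V) (hadd : ∀ x ∈ V, ∀ y ∈ V, x + y ∈ V)
    (z : Fin n → ZMod 2) (i : Fin n) :
    |EE p (fun T => (cw V (z + Pi.single i 1 + T) : ℝ)) - EE p (fun T => (cw V (z + T) : ℝ))|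
      ≤ Real.exp (-(2 * (p * (1 - p)) ^ (q - 1) * (δ * n))) := by
  classical
  rcases hC i with hi | ⟨F, hcard, hF, hdis⟩
  · rw [← hV] at hi
    have : ∀ T, cw V (z + Pi.single i 1 + T) = cw V (z + T) := by
      intro T
      rw [add_right_comm, cw_add_mem hV0 hadd _ _ hi]
    simp only [this, sub_self, abs_zero]
    positivity
  rw [← EE_sub]
  have hρ0 : 0 ≤ (p * (1 - p)) ^ (q - 1) := by
    have : 0 ≤ 1 - p := by linarith
    positivity
  have hρ1 : (p * (1 - p)) ^ (q - 1) ≤ 1 / 2 := by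
    have e1 : 0 ≤ p * (1 - p) := mul_nonneg h0 (by linarith)
    have e2 : p * (1 - p) ≤ 1 / 2 := by nlinarith [sq_nonneg (p - 1 / 2)]
    calc (p * (1 - p)) ^ (q - 1) ≤ p * (1 - p) :=
          pow_le_of_le_one e1 (by linarith) (by omega)
      _ ≤ 1 / 2 := e2
  let A : (Fin n → ZMod 2) → Finset (Fin n) := fun y => {j | y j ≠ 0 ∧ j ≠ i}
  have hA : ∀ y ∈ F, (A y).card = q := by
    intro y hy
    obtain ⟨_, hw, hyi⟩ := hF y hy
    have : A y = (Finset.univ.filter (fun j => y j ≠ 0)).erase i := by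
      ext j; simp [A, and_comm]
    rw [this, Finset.card_erase_of_mem (by simpa using hyi)]
    unfold hammingNorm at hw
    omega
  have hb : ∀ y : Fin n → ZMod 2, ∃ b, y ∈ F → b ∈ A y := by
    intro y
    by_cases hy : y ∈ F
    · have : (A y).Nonempty := Finset.card_pos.1 (by rw [hA y hy]; omega)
      exact ⟨this.choose, fun _ => this.choose_spec⟩
    · exact ⟨i, fun h => absurd h hy⟩
  choose b hb using hb
  have hpw : ∀ y ∈ F, ∀ T, (A y).piecewise (T + 1) T = T + Pi.single i 1 + y := by
    intro y hy T
    obtain ⟨_, hw, hyi⟩ := hF y hy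
    have two : (1 : ZMod 2) + 1 = 0 := by decide
    funext j
    by_cases hji : j = i
    · subst hji
      have : y j = 1 := (zmod2_cases _).resolve_left hyi
      simp [Finset.piecewise, A, this, add_assoc, two]
    · rcases zmod2_cases (y j) with h | h <;> simp [Finset.piecewise, A, h, hji]
  have main := EE_anti_bound (q := q) hq h0 h1 F A b hb hA ?_
    (fun T => (cw V (z + Pi.single i 1 + T) : ℝ) - (cw V (z + T) : ℝ)) ?_ ?_
  · refine main.trans ?_
    calc (1 - 2 * (p * (1 - p)) ^ (q - 1)) ^ F.card
        ≤ (Real.exp (-(2 * (p * (1 - p)) ^ (q - 1)))) ^ F.card := by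
          apply pow_le_pow_left₀ (by linarith)
          have := Real.add_one_le_exp (-(2 * (p * (1 - p)) ^ (q - 1)))
          linarith
      _ = Real.exp (F.card * (-(2 * (p * (1 - p)) ^ (q - 1)))) := by rw [Real.exp_nat_mul]
      _ ≤ _ := by
          apply Real.exp_le_exp.2
          nlinarith
  · intro y hy y' hy' hne
    rw [Finset.disjoint_left]
    intro j hj hj'
    simp only [A, Finset.mem_filter, Finset.mem_univ, true_and] at hj hj'
    exact hdis y hy y' hy' hne j hj.2 ⟨hj.1, hj'.1⟩
  · intro T
    have a1 := cw_add_le hV0 (z + T) (Pi.single i 1)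
    have a2 := cw_add_le hV0 (z + Pi.single i 1 + T) (Pi.single i 1)
    have r1 : z + T + Pi.single i 1 = z + Pi.single i 1 + T := by abel
    have r2 : z + Pi.single i 1 + T + Pi.single i 1 = z + T := by
      have : z + Pi.single i 1 + T + Pi.single i 1
        = z + T + (Pi.single i 1 + Pi.single i 1 : Fin n → ZMod 2) := by abel
      rw [this, add_self', add_zero]
    rw [r1] at a1
    rw [r2] at a2
    have a3 := norm_single i
    have b1 : cw V (z + Pi.single i 1 + T) ≤ cw V (z + T) + 1 := by omega
    have b2 : cw V (z + T) ≤ cw V (z + Pi.single i 1 + T) + 1 := by omega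
    have c1 : (cw V (z + Pi.single i 1 + T) : ℝ) ≤ cw V (z + T) + 1 := by exact_mod_cast b1
    have c2 : (cw V (z + T) : ℝ) ≤ cw V (z + Pi.single i 1 + T) + 1 := by exact_mod_cast b2
    rw [abs_le]; constructor <;> linarith
  · intro y hy T
    have hyV : y ∈ V := by rw [hV]; exact (hF y hy).1
    simp only [hpw y hy T]
    have r1 : z + Pi.single i 1 + (T + Pi.single i 1 + y) = z + T + y := by
      have : z + Pi.single i 1 + (T + Pi.single i 1 + y)
        = z + T + y + (Pi.single i 1 + Pi.single i 1 : Fin n → ZMod 2) := by abel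
      rw [this, add_self', add_zero]
    have r2 : z + (T + Pi.single i 1 + y) = z + Pi.single i 1 + T + y := by abel
    rw [r1, r2, cw_add_mem hV0 hadd _ _ hyV, cw_add_mem hV0 hadd _ _ hyV]
    ring

lemma lip {n : ℕ} (G : (Fin n → ZMod 2) → ℝ) (θ : ℝ)
    (h : ∀ z i, |G (z + Pi.single i 1) - G z| ≤ θ) (x : Fin n → ZMod 2) :
    G x - G 0 ≤ θ * hammingNorm x := by
  classical
  have key : ∀ S : Finset (Fin n),
      G (∑ i ∈ S, Pi.single i 1) - G 0 ≤ θ * S.card := by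
    intro S
    induction S using Finset.induction_on with
    | empty => simp
    | insert a s ha ih =>
      rw [Finset.sum_insert ha, Finset.card_insert_of_notMem ha, add_comm]
      have := (abs_le.1 (h (∑ i ∈ s, Pi.single i 1) a)).2
      push_cast
      linarith
  have hx : x = ∑ i ∈ Finset.univ.filter (fun i => x i ≠ 0), Pi.single i 1 := by
    funext j
    rw [Finset.sum_apply]
    rcases zmod2_cases (x j) with hj | hj <;> simp [Pi.single_apply, hj]
  have := key (Finset.univ.filter (fun i => x i ≠ 0))
  rw [← hx] at this
  exact this

end LCCproof

/-- For a `q`-locally correctable code, the covering radius of `C^⊥` is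
`O(n^{(q-2)/(q-1)})`. -/
theorem LCC_covering_radius
    (q : ℕ) (hq : 2 ≤ q) (δ : ℝ) (hδ0 : 0 < δ) (hδ1 : δ < 1 / (q : ℝ)) :
    ∃ c : ℝ, 0 < c ∧
      ∀ n : ℕ, 1 ≤ n → ∀ C : Submodule (ZMod 2) (Fin n → ZMod 2),
        IsLocallyCorrectable n q δ C →
        ∀ x : Fin n → ZMod 2, ∃ y ∈ dualSet (C : Set (Fin n → ZMod 2)),
          (hammingDist x y : ℝ) ≤ c * (n : ℝ) ^ (((q : ℝ) - 2) / ((q : ℝ) - 1)) := by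
  have hq1 : (0 : ℝ) < (q : ℝ) - 1 := by
    have : (2 : ℝ) ≤ q := by exact_mod_cast hq
    linarith
  set β : ℝ := 2 * δ / 4 ^ (q - 1) with hβ
  have hβ0 : 0 < β := by positivity
  have hθ : Real.exp (-β) < 1 := by
    rw [Real.exp_lt_one_iff]; linarith
  refine ⟨1 / (1 - Real.exp (-β)), by apply one_div_pos.2; linarith, ?_⟩
  intro n hn C hC x
  obtain ⟨V, hV⟩ : ∃ V, V = dualSet (C : Set (Fin n → ZMod 2)) := ⟨_, rfl⟩
  have hV0 : (0 : Fin n → ZMod 2) ∈ V := by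
    rw [hV]; intro x _; simp
  have hadd : ∀ x ∈ V, ∀ y ∈ V, x + y ∈ V := by
    rw [hV]
    intro x hx y hy c hc
    simp only [Pi.add_apply, mul_add, Finset.sum_add_distrib]
    rw [hx c hc, hy c hc, add_zero]
  have hn0 : (0 : ℝ) < n := by exact_mod_cast hn
  have hn1 : (1 : ℝ) ≤ n := by exact_mod_cast hn
  set s : ℝ := (n : ℝ) ^ (-(1 / ((q : ℝ) - 1))) with hs
  have hs0 : 0 < s := Real.rpow_pos_of_pos hn0 _
  have hs1 : s ≤ 1 := by
    apply Real.rpow_le_one_of_one_le_of_nonpos hn1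
    have : 0 < 1 / ((q : ℝ) - 1) := by positivity
    linarith
  have hspow : s ^ (q - 1) = (n : ℝ)⁻¹ := by
    rw [hs, ← Real.rpow_natCast, ← Real.rpow_mul hn0.le, ← Real.rpow_neg_one]
    congr 1
    rw [Nat.cast_sub (by omega)]
    push_cast
    field_simp
  have hsn : s * n = (n : ℝ) ^ (((q : ℝ) - 2) / ((q : ℝ) - 1)) := by
    rw [hs]
    nth_rewrite 2 [← Real.rpow_one (n : ℝ)]
    rw [← Real.rpow_add hn0]
    congr 1
    field_simp
    ring
  have hlow : β ≤ 2 * (s / 2 * (1 - s / 2)) ^ (q - 1) * (δ * n) := by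
    have h1 : (s / 4) ^ (q - 1) ≤ (s / 2 * (1 - s / 2)) ^ (q - 1) := by
      apply pow_le_pow_left₀ (by positivity)
      nlinarith
    rw [div_pow, hspow] at h1
    have h2 : β = 2 * ((n : ℝ)⁻¹ / 4 ^ (q - 1)) * (δ * n) := by
      rw [hβ]; field_simp
    rw [h2]
    gcongr
  have hp0 : 0 ≤ s / 2 := by positivity
  have hp1 : s / 2 ≤ 1 := by linarith
  set G : (Fin n → ZMod 2) → ℝ :=
    fun z => LCCproof.EE (s / 2) (fun T => (LCCproof.cw V (z + T) : ℝ)) with hG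
  have hlip := LCCproof.lip G (Real.exp (-β)) (fun z i =>
    (LCCproof.diff_bound hq hp0 hp1 C hC V hV hV0 hadd z i).trans
      (Real.exp_le_exp.2 (by linarith)))
  obtain ⟨y, hy, hxy⟩ := LCCproof.cw_spec hV0 x
  refine ⟨y, hV ▸ hy, ?_⟩
  have hl := hlip (x + y)
  have hnorm : hammingNorm (x + y) = LCCproof.cw V x := by
    rw [← hxy, LCCproof.dist_eq]
  have hmean := LCCproof.EE_norm (n := n) (s / 2)
  have hup : G 0 ≤ s / 2 * n := by
    rw [← hmean]
    apply LCCproof.EE_mono hp0 hp1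
    intro T
    have h1 := LCCproof.cw_add_le hV0 0 T
    have h2 : LCCproof.cw V 0 ≤ 0 := by
      simpa using LCCproof.cw_le (V := V) 0 0 hV0
    have h3 : LCCproof.cw V (0 + T) ≤ hammingNorm T := by omega
    exact_mod_cast h3
  have hdn : (LCCproof.cw V x : ℝ) - s / 2 * n ≤ G (x + y) := by
    have e : (LCCproof.cw V x : ℝ) - s / 2 * n = LCCproof.EE (s / 2)
        (fun T : Fin n → ZMod 2 => (LCCproof.cw V x : ℝ) * 1 - (hammingNorm T : ℝ)) := by
      rw [LCCproof.EE_sub, LCCproof.EE_smul, LCCproof.EE_one, hmean, mul_one]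
    rw [e]
    apply LCCproof.EE_mono hp0 hp1
    intro T
    have h1 := LCCproof.cw_add_le hV0 (x + y + T) T
    rw [add_assoc, LCCproof.add_self', add_zero, LCCproof.cw_add_mem hV0 hadd _ _ hy] at h1
    have h2 : (LCCproof.cw V x : ℝ) ≤ LCCproof.cw V (x + y + T) + hammingNorm T := by
      exact_mod_cast h1
    linarith
  rw [hnorm] at hl
  rw [hxy, ← hsn, one_div, inv_mul_eq_div, le_div_iff₀ (by linarith)]
  nlinarith
end

section
/- For every integer q ≥ 2 and every real δ with 0 < δ < 1/q there exists a constant c = c(q,δ) > 0 such that for every n ≥ 2 and every q-locally correctable code C ⊆ F₂ⁿ with density δ, the dimension of C satisfies dim C ≤ c·n^{(q−2)/(q−1)}·(log₂ n)^{1/(q−1)}. -/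
open Classical in
/-- Elements reachable as a sum of at most `d` generators. -/
noncomputable def ballB {V : Type*} [AddCommGroup V] {n : ℕ} (v : Fin n → V) : ℕ → Finset V
  | 0 => {0}
  | d + 1 => ballB v d ∪ (Finset.univ ×ˢ ballB v d).image (fun t : Fin n × V => t.2 + v t.1)

theorem ballB_card {V : Type*} [AddCommGroup V] {n : ℕ} (v : Fin n → V) (d : ℕ) :
    (ballB v d).card ≤ (n + 1) ^ d := by
  classical
  induction d with
  | zero => simp [ballB]
  | succ d ih =>
    rw [ballB]
    refine (Finset.card_union_le _ _).trans ?_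
    have := Finset.card_image_le (s := Finset.univ ×ˢ ballB v d)
      (f := fun t : Fin n × V => t.2 + v t.1)
    rw [Finset.card_product, Finset.card_univ, Fintype.card_fin] at this
    have h2 : (n + 1) * (ballB v d).card ≤ (n+1) * (n+1)^d := Nat.mul_le_mul_left _ ih
    rw [pow_succ]
    have e : ∀ (h : DecidableEq V), (@Finset.image _ _ h (fun t : Fin n × V => t.2 + v t.1) (Finset.univ ×ˢ ballB v d)).card ≤ n * (ballB v d).card := by
      intro h
      convert this
    have := e (fun a b => Classical.propDecidable (a = b))
    nlinarith

theorem ballB_step {V : Type*} [AddCommGroup V] {n : ℕ} (v : Fin n → V) (d : ℕ) (x : V)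
    (hx : x ∈ ballB v d) (j : Fin n) : x + v j ∈ ballB v (d + 1) := by
  classical
  rw [ballB, Finset.mem_union]
  right
  rw [Finset.mem_image]
  exact ⟨(j, x), by simp [hx], rfl⟩

theorem ballB_mono {V : Type*} [AddCommGroup V] {n : ℕ} (v : Fin n → V) :
    Monotone (ballB v) := by
  refine monotone_nat_of_le_succ (fun d x hx => ?_)
  classical
  rw [ballB, Finset.mem_union]
  exact Or.inl hx

theorem ballB_sum {V : Type*} [AddCommGroup V] {n : ℕ} (v : Fin n → V) (s : Finset (Fin n)) :
    ∑ i ∈ s, v i ∈ ballB v s.card := by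
  classical
  induction s using Finset.induction_on with
  | empty => simp [ballB]
  | insert a s ha ih =>
    rw [Finset.sum_insert ha, Finset.card_insert_of_notMem ha, add_comm (v a)]
    exact ballB_step v _ _ ih a

theorem diam_bound {V : Type*} [AddCommGroup V] {n : ℕ} (v : Fin n → V) (β : Type*)
    (h2 : ∀ x : V, x + x = 0)
    (hspan : ∀ x : V, ∃ s : Finset (Fin n), x = ∑ i ∈ s, v i)
    (M : ℝ) (hM : 0 < M) (hMn : 2 * M ≤ n)
    (hrel : ∀ i, v i = 0 ∨ ∃ (A : Finset β) (a b : β → Fin n), M ≤ A.card ∧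
      Set.InjOn a A ∧ Set.InjOn b A ∧ (∀ y ∈ A, ∀ z ∈ A, a y ≠ b z) ∧
      ∀ y ∈ A, v i = v (a y) + v (b y)) (x : V) : x ∈ ballB v ⌊n / M⌋₊ := by
  classical
  have hex : ∀ x, ∃ d, x ∈ ballB v d := by
    intro x
    obtain ⟨s, rfl⟩ := hspan x
    exact ⟨_, ballB_sum v s⟩
  let N : V → ℕ := fun x => Nat.find (hex x)
  have hN : ∀ x, x ∈ ballB v (N x) := fun x => Nat.find_spec (hex x)
  have hNle : ∀ x d, x ∈ ballB v d → N x ≤ d := fun x d h => Nat.find_min' (hex x) h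
  have hN0 : N 0 = 0 := by
    have := hNle 0 0 (by simp [ballB])
    omega
  have hstep : ∀ x j, N (x + v j) ≤ N x + 1 := fun x j => hNle _ _ (ballB_step v _ _ (hN x) j)
  have hstep' : ∀ x j, N x ≤ N (x + v j) + 1 := by
    intro x j
    have := hstep (x + v j) j
    rwa [add_assoc, h2, add_zero] at this
  let f : V → ℝ := fun x => ∑ j, (N (x + v j) : ℝ)
  have hlip : ∀ x i, f (x + v i) ≤ f x + (n - 2 * M) := by
    intro x i
    rcases hrel i with h0 | ⟨A, a, b, hA, ha, hb, hab, hv⟩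
    · rw [h0, add_zero]; linarith
    let J := A.image a ∪ A.image b
    have hdisj : Disjoint (A.image a) (A.image b) := by
      rw [Finset.disjoint_left]
      intro t h1 h2
      simp only [Finset.mem_image] at h1 h2
      obtain ⟨y, hy, rfl⟩ := h1
      obtain ⟨z, hz, hzy⟩ := h2
      exact hab y hy z hz hzy.symm
    have hJc : (J.card : ℝ) = 2 * A.card := by
      have : J.card = 2 * A.card := by
        rw [Finset.card_union_of_disjoint hdisj, Finset.card_image_of_injOn ha,
          Finset.card_image_of_injOn hb]; ring
      rw [this]; push_cast; ring
    have hsumJ : ∀ g : Fin n → ℝ, ∑ j ∈ J, g j = ∑ y ∈ A, (g (a y) + g (b y)) := by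
      intro g
      rw [Finset.sum_union hdisj, Finset.sum_image ha, Finset.sum_image hb,
        Finset.sum_add_distrib]
    have hJ : ∑ j ∈ J, (N (x + v i + v j) : ℝ) = ∑ j ∈ J, (N (x + v j) : ℝ) := by
      rw [hsumJ, hsumJ]
      refine Finset.sum_congr rfl (fun y hy => ?_)
      have e1 : x + v i + v (a y) = x + v (b y) := by
        rw [hv y hy]
        calc x + (v (a y) + v (b y)) + v (a y) = x + v (b y) + (v (a y) + v (a y)) := by abel
          _ = _ := by rw [h2, add_zero]
      have e2 : x + v i + v (b y) = x + v (a y) := by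
        rw [hv y hy]
        calc x + (v (a y) + v (b y)) + v (b y) = x + v (a y) + (v (b y) + v (b y)) := by abel
          _ = _ := by rw [h2, add_zero]
      rw [e1, e2, add_comm]
    have hJ' : ∑ j ∈ Jᶜ, (N (x + v i + v j) : ℝ) ≤ ∑ j ∈ Jᶜ, ((N (x + v j) : ℝ) + 1) := by
      refine Finset.sum_le_sum (fun j _ => ?_)
      have := hstep (x + v j) i
      rw [add_right_comm] at this
      exact_mod_cast this
    have hc : (Jᶜ.card : ℝ) = n - J.card := by
      rw [Finset.card_compl, Fintype.card_fin, Nat.cast_sub]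
      simpa using Finset.card_le_univ J
    rw [Finset.sum_add_distrib, Finset.sum_const, nsmul_eq_mul, mul_one, hc, hJc] at hJ'
    have s1 := Finset.sum_add_sum_compl J (fun j => (N (x + v i + v j) : ℝ))
    have s2 := Finset.sum_add_sum_compl J (fun j => (N (x + v j) : ℝ))
    show ∑ j, (N (x + v i + v j) : ℝ) ≤ ∑ j, (N (x + v j) : ℝ) + (n - 2 * M)
    linarith
  have hf0 : f 0 ≤ n := by
    have : f 0 ≤ ∑ j : Fin n, (1:ℝ) := by
      refine Finset.sum_le_sum (fun j _ => ?_)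
      have := hstep 0 j
      rw [hN0] at this
      exact_mod_cast this
    simpa using this
  have hup : ∀ d x, x ∈ ballB v d → f x ≤ f 0 + d * (n - 2 * M) := by
    intro d
    induction d with
    | zero => intro x hx; simp [ballB] at hx; simp [hx]
    | succ d ih =>
      intro x hx
      rw [ballB, Finset.mem_union, Finset.mem_image] at hx
      push_cast
      rcases hx with hx | ⟨⟨j, y⟩, hy, rfl⟩
      · have := ih x hx; nlinarith
      · have := ih y (by simpa using hy)
        have := hlip y j
        simp only
        linarith
  have hlow : (n : ℝ) * (N x - 1) ≤ f x := by
    have : ∑ j : Fin n, ((N x : ℝ) - 1) ≤ f x := by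
      refine Finset.sum_le_sum (fun j _ => ?_)
      have := hstep' x j
      have : (N x : ℝ) ≤ N (x + v j) + 1 := by exact_mod_cast this
      linarith
    rwa [Finset.sum_const, Finset.card_univ, Fintype.card_fin, nsmul_eq_mul] at this
  have := hup _ x (hN x)
  have h3 : (N x : ℝ) ≤ n / M := by
    rw [le_div_iff₀ hM]
    nlinarith
  exact ballB_mono v (Nat.le_floor h3) (hN x)


noncomputable def wt (n : ℕ) (p : ℝ) (S : Finset (Fin n)) : ℝ := p ^ S.card * (1 - p) ^ (n - S.card)

open Classical in
theorem wt_sup (n : ℕ) (p : ℝ) (U : Finset (Fin n)) :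
    ∑ S, wt n p S * (if U ⊆ S then 1 else 0) = p ^ U.card := by
  have h := Finset.prod_add (fun _ : Fin n => p) (fun i => if i ∈ U then 0 else 1 - p) Finset.univ
  have h1 : ∏ i : Fin n, (p + if i ∈ U then 0 else 1 - p) = p ^ U.card := by
    rw [← Finset.prod_const, ← Finset.prod_subset (Finset.subset_univ U)]
    · exact Finset.prod_congr rfl (fun i hi => by simp [hi])
    · intro i _ hi; simp [hi]
  rw [h1] at h
  rw [h, Finset.powerset_univ]
  refine Finset.sum_congr rfl (fun S _ => ?_)
  rw [Finset.prod_const, wt, mul_assoc]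
  congr 1
  split_ifs with hU
  · rw [mul_one, Finset.prod_congr rfl (g := fun _ => 1 - p), Finset.prod_const]
    · congr 1
      rw [Finset.card_sdiff_of_subset (Finset.subset_univ S)]; simp
    · intro i hi
      have : i ∉ U := fun h => (Finset.mem_sdiff.1 hi).2 (hU h)
      simp [this]
  · rw [mul_zero]
    obtain ⟨i, hi, hiS⟩ := Finset.not_subset.1 hU
    symm
    exact Finset.prod_eq_zero (i := i) (by simp [hiS]) (by simp [hi])

open Classical in
theorem wt_prod {β : Type*} (n r : ℕ) (p t : ℝ) (F : Finset β) (T : β → Finset (Fin n))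
    (hc : ∀ y ∈ F, (T y).card = r)
    (hd : ∀ y ∈ F, ∀ z ∈ F, y ≠ z → Disjoint (T y) (T z)) :
    ∑ S, wt n p S * ∏ y ∈ F, (1 + t * (if T y ⊆ S then 1 else 0)) = (1 + t * p ^ r) ^ F.card := by
  have h1 : ∀ S : Finset (Fin n), ∏ y ∈ F, (1 + t * (if T y ⊆ S then 1 else 0)) =
      ∑ A ∈ F.powerset, t ^ A.card * (if A.biUnion T ⊆ S then 1 else 0) := by
    intro S
    rw [Finset.prod_one_add]
    refine Finset.sum_congr rfl (fun A _ => ?_)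
    rw [Finset.prod_mul_distrib, Finset.prod_const, Finset.prod_ite_zero]
    simp
  simp_rw [h1, Finset.mul_sum]
  rw [Finset.sum_comm, ← Finset.prod_const, Finset.prod_one_add]
  refine Finset.sum_congr rfl (fun A hA => ?_)
  rw [Finset.mem_powerset] at hA
  have : ∀ S, wt n p S * (t ^ A.card * (if A.biUnion T ⊆ S then 1 else 0)) =
    t ^ A.card * (wt n p S * (if A.biUnion T ⊆ S then 1 else 0)) := fun S => by ring
  simp_rw [this]
  rw [← Finset.mul_sum, wt_sup, Finset.prod_const, mul_pow, ← pow_mul, Finset.card_biUnion,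
    Finset.sum_congr rfl (fun y hy => hc y (hA hy))]
  · simp [mul_comm]
  · intro y hy z hz hyz; exact hd y (hA hy) z (hA hz) hyz

open Classical in
theorem exists_sample {β : Type*} (n r : ℕ) (hn : 0 < n) (p m : ℝ) (hp0 : 0 < p) (hp1 : p ≤ 1)
    (G : Finset (Fin n)) (F : Fin n → Finset β) (T : Fin n → β → Finset (Fin n))
    (hm : ∀ i ∈ G, m ≤ (F i).card)
    (hc : ∀ i ∈ G, ∀ y ∈ F i, (T i y).card = r)
    (hd : ∀ i ∈ G, ∀ y ∈ F i, ∀ z ∈ F i, y ≠ z → Disjoint (T i y) (T i z))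
    (hexp : n * Real.exp (-(m * p ^ r / 4)) < 1 / 2) :
    ∃ S : Finset (Fin n), (S.card : ℝ) ≤ 2 * p * n ∧
      ∀ i ∈ G, m * p ^ r / 4 ≤ ((F i).filter (fun y => T i y ⊆ S)).card := by
  by_contra! hcon
  set a := m * p ^ r / 4 with ha
  have hw : ∀ S, 0 ≤ wt n p S := fun S => by
    unfold wt
    have : 0 ≤ 1 - p := by linarith
    positivity
  have hn' : (0:ℝ) < n := by exact_mod_cast hn
  have hX : ∀ i S, ∏ y ∈ F i, (1 + (-1/2 : ℝ) * (if T i y ⊆ S then 1 else 0)) =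
      (1/2) ^ ((F i).filter (fun y => T i y ⊆ S)).card := by
    intro i S
    rw [← Finset.prod_const, Finset.prod_filter]
    refine Finset.prod_congr rfl (fun y _ => ?_)
    split_ifs <;> norm_num
  have hlow : ∀ S : Finset (Fin n), 1 ≤ (S.card : ℝ) / (2 * p * n) + ∑ i ∈ G, Real.exp a *
      ∏ y ∈ F i, (1 + (-1/2 : ℝ) * (if T i y ⊆ S then 1 else 0)) := by
    intro S
    simp_rw [hX]
    by_cases hS : (S.card : ℝ) ≤ 2 * p * n
    · obtain ⟨i, hi, hlt⟩ := hcon S hS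
      have h1 : 1 ≤ Real.exp a * (1/2) ^ ((F i).filter (fun y => T i y ⊆ S)).card := by
        have h2 : Real.exp (-1) ≤ 1/2 := by
          rw [Real.exp_neg, one_div]
          apply inv_anti₀ (by norm_num)
          have := Real.add_one_le_exp (1:ℝ)
          linarith
        have h3 := pow_le_pow_left₀ (Real.exp_pos (-1)).le h2 ((F i).filter (fun y => T i y ⊆ S)).card
        refine le_trans ?_ (mul_le_mul_of_nonneg_left h3 (Real.exp_pos a).le)
        rw [← Real.exp_nat_mul, ← Real.exp_add]
        apply Real.one_le_exp
        linarith
      have h4 := Finset.single_le_sum (f := fun i => Real.exp a *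
        (1/2) ^ ((F i).filter (fun y => T i y ⊆ S)).card) (fun j _ => by positivity) hi
      have : 0 ≤ (S.card : ℝ) / (2 * p * n) := by positivity
      linarith
    · have : 1 ≤ (S.card : ℝ) / (2 * p * n) := by
        rw [le_div_iff₀ (by positivity)]; linarith
      have : 0 ≤ ∑ i ∈ G, Real.exp a * (1/2) ^ ((F i).filter (fun y => T i y ⊆ S)).card :=
        Finset.sum_nonneg (fun j _ => by positivity)
      linarith
  have hE1 : ∑ S, wt n p S = 1 := by simpa using wt_sup n p ∅
  have hE2 : ∑ S, wt n p S * (S.card : ℝ) = n * p := by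
    have : ∀ S : Finset (Fin n), (S.card : ℝ) = ∑ i, if {i} ⊆ S then 1 else 0 := by
      intro S; simp
    simp_rw [this, Finset.mul_sum]
    rw [Finset.sum_comm]
    simp_rw [wt_sup]
    simp
  have hsum := Finset.sum_le_sum (s := Finset.univ)
    (fun S _ => mul_le_mul_of_nonneg_left (hlow S) (hw S))
  simp_rw [mul_one, mul_add, Finset.sum_add_distrib, hE1, mul_div_assoc', Finset.mul_sum] at hsum
  rw [← Finset.sum_div, hE2, Finset.sum_comm] at hsum
  have hi : ∀ i ∈ G, ∑ S, wt n p S * (Real.exp a *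
      ∏ y ∈ F i, (1 + (-1/2 : ℝ) * (if T i y ⊆ S then 1 else 0))) ≤ Real.exp (-a) := by
    intro i hi
    simp_rw [mul_left_comm (wt n p _)]
    rw [← Finset.mul_sum, wt_prod n r p _ (F i) (T i) (hc i hi) (hd i hi)]
    have hpr : p ^ r ≤ 1 := pow_le_one₀ hp0.le hp1
    have h1 : 1 + -1/2 * p ^ r ≤ Real.exp (-(p^r/2)) := by
      have := Real.add_one_le_exp (-(p^r/2)); linarith
    have h2 := pow_le_pow_left₀ (by linarith) h1 (F i).card
    refine (mul_le_mul_of_nonneg_left h2 (Real.exp_pos a).le).trans ?_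
    rw [← Real.exp_nat_mul, ← Real.exp_add]
    apply Real.exp_le_exp.2
    have := mul_le_mul_of_nonneg_right (hm i hi) (pow_pos hp0 r).le
    rw [ha]
    linarith
  have h5 := Finset.sum_le_sum hi
  rw [Finset.sum_const, nsmul_eq_mul] at h5
  have h6 : (G.card : ℝ) ≤ n := by
    have := Finset.card_le_univ G
    rw [Fintype.card_fin] at this
    exact_mod_cast this
  have h7 := mul_le_mul_of_nonneg_right h6 (Real.exp_pos (-a)).le
  have h8 : n * p / (2 * p * n) = 1/2 := by field_simp
  rw [h8] at hsum
  linarith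

/-- The subcode of `C` of the words vanishing on `S`. -/
def subcode {n : ℕ} (C : Submodule (ZMod 2) (Fin n → ZMod 2)) (S : Finset (Fin n)) :
    Submodule (ZMod 2) C :=
  LinearMap.ker ((LinearMap.funLeft (ZMod 2) (ZMod 2) (Subtype.val : S → Fin n)).comp C.subtype)

theorem mem_subcode {n : ℕ} {C : Submodule (ZMod 2) (Fin n → ZMod 2)} {S : Finset (Fin n)}
    {x : C} (hx : x ∈ subcode C S) (s : Fin n) (hs : s ∈ S) : (x : Fin n → ZMod 2) s = 0 := by
  have := congrFun (LinearMap.mem_ker.1 hx) ⟨s, hs⟩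
  simpa using this

theorem finrank_subcode {n : ℕ} (C : Submodule (ZMod 2) (Fin n → ZMod 2)) (S : Finset (Fin n)) :
    Module.finrank (ZMod 2) C ≤ S.card + Module.finrank (ZMod 2) (subcode C S) := by
  have h := LinearMap.finrank_range_add_finrank_ker
    ((LinearMap.funLeft (ZMod 2) (ZMod 2) (Subtype.val : S → Fin n)).comp C.subtype)
  have h2 := Submodule.finrank_le (LinearMap.range
    ((LinearMap.funLeft (ZMod 2) (ZMod 2) (Subtype.val : S → Fin n)).comp C.subtype))
  rw [Module.finrank_pi, Fintype.card_coe] at h2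
  unfold subcode
  omega

/-- Coordinate functionals on the subcode. -/
def coordF {n : ℕ} (C : Submodule (ZMod 2) (Fin n → ZMod 2)) (S : Finset (Fin n)) (i : Fin n) :
    Module.Dual (ZMod 2) (subcode C S) :=
  ((LinearMap.proj i).comp C.subtype).comp (subcode C S).subtype

theorem coordF_apply {n : ℕ} (C : Submodule (ZMod 2) (Fin n → ZMod 2)) (S : Finset (Fin n))
    (i : Fin n) (x : subcode C S) : coordF C S i x = ((x : C) : Fin n → ZMod 2) i := rfl

theorem coordF_span {n : ℕ} (C : Submodule (ZMod 2) (Fin n → ZMod 2)) (S : Finset (Fin n))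
    (f : Module.Dual (ZMod 2) (subcode C S)) : ∃ s : Finset (Fin n), f = ∑ i ∈ s, coordF C S i := by
  obtain ⟨g, hg⟩ := LinearMap.exists_extend f
  obtain ⟨k, hk⟩ := LinearMap.exists_extend g
  refine ⟨Finset.univ.filter (fun i => k (Pi.single i 1) ≠ 0), ?_⟩
  ext x
  have h1 : f x = k ((x : C) : Fin n → ZMod 2) := by
    rw [← hg, ← hk]; rfl
  rw [h1, LinearMap.sum_apply, Finset.sum_filter, LinearMap.pi_apply_eq_sum_univ k]
  refine Finset.sum_congr rfl (fun i _ => ?_)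
  rw [coordF_apply]
  have e : (fun j => if i = j then (1 : ZMod 2) else 0) = Pi.single i 1 := by
    ext j; simp [Pi.single_apply, eq_comm]
  rw [e]
  have : ∀ z : ZMod 2, z = 0 ∨ z = 1 := by decide
  rcases this (k (Pi.single i 1)) with h | h <;> simp [h]

theorem dual_card {n : ℕ} (C : Submodule (ZMod 2) (Fin n → ZMod 2)) (S : Finset (Fin n)) :
    Nat.card (Module.Dual (ZMod 2) (subcode C S)) = 2 ^ Module.finrank (ZMod 2) (subcode C S) := by
  rw [Module.natCard_eq_pow_finrank (K := ZMod 2), Subspace.dual_finrank_eq, Nat.card_zmod]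

/-- Splitting of a weight `q+1` vector through `i`. -/
theorem split_support {n q : ℕ} (hq : 2 ≤ q) (i : Fin n) (y : Fin n → ZMod 2)
    (hw : hammingNorm y = q + 1) (hi : y i ≠ 0) :
    ∃ (a b : Fin n) (T : Finset (Fin n)), a ≠ b ∧ a ≠ i ∧ b ≠ i ∧ y a ≠ 0 ∧ y b ≠ 0 ∧
      T.card = q - 2 ∧ (∀ t ∈ T, t ≠ i ∧ y t ≠ 0) ∧
      ∀ x : Fin n → ZMod 2, ∑ j, x j * y j = x i + (x a + (x b + ∑ t ∈ T, x t)) := by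
  have hP : (Finset.univ.filter (fun j => y j ≠ 0)).card = q + 1 := hw
  set P := Finset.univ.filter (fun j => y j ≠ 0) with hPdef
  have hiP : i ∈ P := by simp [hPdef, hi]
  have h1 : (P.erase i).card = q := by rw [Finset.card_erase_of_mem hiP, hP]; rfl
  obtain ⟨a, ha⟩ := Finset.card_pos.1 (show 0 < (P.erase i).card by omega)
  have h2 : ((P.erase i).erase a).card = q - 1 := by rw [Finset.card_erase_of_mem ha, h1]
  obtain ⟨b, hb⟩ := Finset.card_pos.1 (show 0 < ((P.erase i).erase a).card by omega)
  have h3 : (((P.erase i).erase a).erase b).card = q - 2 := by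
    rw [Finset.card_erase_of_mem hb, h2]; omega
  have ha' := ha
  have hb' := hb
  simp only [hPdef, Finset.mem_erase, Finset.mem_filter, Finset.mem_univ, true_and] at ha' hb'
  refine ⟨a, b, _, fun h => hb'.1 h.symm, ha'.1, hb'.2.1, ha'.2, hb'.2.2, h3, ?_, ?_⟩
  · intro t ht
    simp only [hPdef, Finset.mem_erase, Finset.mem_filter, Finset.mem_univ, true_and] at ht
    exact ⟨ht.2.2.1, ht.2.2.2⟩
  · intro x
    rw [Finset.add_sum_erase _ _ hb, Finset.add_sum_erase _ _ ha, Finset.add_sum_erase _ _ hiP,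
      hPdef, Finset.sum_filter]
    refine Finset.sum_congr rfl (fun j _ => ?_)
    have : ∀ z : ZMod 2, z = 0 ∨ z = 1 := by decide
    rcases this (y j) with h | h <;> simp [h]

theorem core_bound (q : ℕ) (hq : 2 ≤ q) (δ : ℝ) (hδ0 : 0 < δ) (hδ1 : δ < 1)
    (n : ℕ) (hn : 2 ≤ n) (C : Submodule (ZMod 2) (Fin n → ZMod 2))
    (hC : IsLocallyCorrectable n q δ C) (p : ℝ) (hp0 : 0 < p) (hp1 : p ≤ 1)
    (hexp : n * Real.exp (-(δ * n * p ^ (q - 2) / 4)) < 1 / 2) :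
    (Module.finrank (ZMod 2) C : ℝ) ≤
      2 * p * n + 4 / (δ * p ^ (q - 2)) * (2 * Real.logb 2 n) := by
  classical
  have hn' : (2 : ℝ) ≤ n := by exact_mod_cast hn
  let G : Finset (Fin n) :=
    Finset.univ.filter (fun i => ¬ Pi.single i 1 ∈ dualSet (C : Set (Fin n → ZMod 2)))
  have hF : ∀ i : Fin n, ∃ F : Finset (Fin n → ZMod 2), i ∈ G →
      δ * n ≤ (F.card : ℝ) ∧
      (∀ y ∈ F, y ∈ dualSet (C : Set (Fin n → ZMod 2)) ∧ hammingNorm y = q + 1 ∧ y i ≠ 0) ∧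
      (∀ y ∈ F, ∀ z ∈ F, y ≠ z → ∀ j : Fin n, j ≠ i → ¬(y j ≠ 0 ∧ z j ≠ 0)) := by
    intro i
    rcases hC i with h | ⟨F, h⟩
    · exact ⟨∅, fun hi => absurd h (Finset.mem_filter.1 hi).2⟩
    · exact ⟨F, fun _ => h⟩
  choose F hF using hF
  have hS : ∀ (i : Fin n) (y : Fin n → ZMod 2), ∃ (a b : Fin n) (T : Finset (Fin n)),
      i ∈ G → y ∈ F i → a ≠ b ∧ a ≠ i ∧ b ≠ i ∧ y a ≠ 0 ∧ y b ≠ 0 ∧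
      T.card = q - 2 ∧ (∀ t ∈ T, t ≠ i ∧ y t ≠ 0) ∧
      ∀ x : Fin n → ZMod 2, ∑ j, x j * y j = x i + (x a + (x b + ∑ t ∈ T, x t)) := by
    intro i y
    by_cases h : i ∈ G ∧ y ∈ F i
    · obtain ⟨_, hw, hi⟩ := (hF i h.1).2.1 y h.2
      obtain ⟨a, b, T, hh⟩ := split_support hq i y hw hi
      exact ⟨a, b, T, fun _ _ => hh⟩
    · exact ⟨i, i, ∅, fun h1 h2 => absurd ⟨h1, h2⟩ h⟩
  choose a b T hS using hS
  obtain ⟨S, hScard, hSG⟩ := exists_sample n (q - 2) (by omega) p (δ * n) hp0 hp1 G F T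
    (fun i hi => (hF i hi).1)
    (fun i hi y hy => (hS i y hi hy).2.2.2.2.2.1)
    (fun i hi y hy z hz hyz => by
      rw [Finset.disjoint_left]
      intro t ht ht'
      have h1 := (hS i y hi hy).2.2.2.2.2.2.1 t ht
      have h2 := (hS i z hi hz).2.2.2.2.2.2.1 t ht'
      exact (hF i hi).2.2 y hy z hz hyz t h1.1 ⟨h1.2, h2.2⟩) hexp
  have hpr : p ^ (q - 2) ≤ 1 := pow_le_one₀ hp0.le hp1
  have hpr0 : 0 < p ^ (q - 2) := pow_pos hp0 _
  set M := δ * n * p ^ (q - 2) / 4 with hMdef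
  have hM0 : 0 < M := by positivity
  have hMn : 2 * M ≤ n := by
    have : δ * p ^ (q - 2) ≤ 1 := by nlinarith
    have : δ * p ^ (q - 2) * n ≤ 1 * n := mul_le_mul_of_nonneg_right this (by linarith)
    rw [hMdef]; linarith
  have z2 : ∀ z : ZMod 2, z + z = 0 := by decide
  have hball := diam_bound (coordF C S) (Fin n → ZMod 2)
    (fun f => by ext x; exact z2 _) (coordF_span C S) M hM0 hMn (by
      intro i
      by_cases hi : i ∈ G
      · right
        refine ⟨(F i).filter (fun y => T i y ⊆ S), a i, b i, hSG i hi, ?_, ?_, ?_, ?_⟩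
        · intro y hy z hz hyz
          simp only [Finset.coe_filter, Set.mem_setOf_eq] at hy hz
          by_contra hne
          have h1 := hS i y hi hy.1
          have h2 := hS i z hi hz.1
          exact (hF i hi).2.2 y hy.1 z hz.1 hne (a i y) h1.2.1
            ⟨h1.2.2.2.1, by rw [hyz]; exact h2.2.2.2.1⟩
        · intro y hy z hz hyz
          simp only [Finset.coe_filter, Set.mem_setOf_eq] at hy hz
          by_contra hne
          have h1 := hS i y hi hy.1
          have h2 := hS i z hi hz.1
          exact (hF i hi).2.2 y hy.1 z hz.1 hne (b i y) h1.2.2.1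
            ⟨h1.2.2.2.2.1, by rw [hyz]; exact h2.2.2.2.2.1⟩
        · intro y hy z hz hyz
          rw [Finset.mem_filter] at hy hz
          have h1 := hS i y hi hy.1
          have h2 := hS i z hi hz.1
          by_cases hne : y = z
          · subst hne; exact h1.1 hyz
          · exact (hF i hi).2.2 y hy.1 z hz.1 hne (a i y) h1.2.1
              ⟨h1.2.2.2.1, by rw [hyz]; exact h2.2.2.2.2.1⟩
        · intro y hy
          rw [Finset.mem_filter] at hy
          ext x
          rw [LinearMap.add_apply, coordF_apply, coordF_apply, coordF_apply]
          have h1 := (hS i y hi hy.1).2.2.2.2.2.2.2 ((x : C) : Fin n → ZMod 2)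
          have h2 := ((hF i hi).2.1 y hy.1).1 _ (x : C).2
          rw [h2, Finset.sum_eq_zero (s := T i y)
            (fun t ht => mem_subcode x.2 t (hy.2 ht))] at h1
          revert h1
          generalize ((x : C) : Fin n → ZMod 2) i = u
          generalize ((x : C) : Fin n → ZMod 2) (a i y) = v
          generalize ((x : C) : Fin n → ZMod 2) (b i y) = w
          revert u v w
          decide
      · left
        have hi' : Pi.single i 1 ∈ dualSet (C : Set (Fin n → ZMod 2)) := by
          by_contra h
          exact hi (Finset.mem_filter.2 ⟨Finset.mem_univ _, h⟩)
        ext x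
        have := hi' _ (x : C).2
        simpa [Pi.single_apply, coordF_apply] using this)
  have hcard : 2 ^ Module.finrank (ZMod 2) (subcode C S) ≤ (n + 1) ^ ⌊n / M⌋₊ := by
    rw [← dual_card]
    refine le_trans ?_ (ballB_card (coordF C S) _)
    have : (Set.univ : Set (Module.Dual (ZMod 2) (subcode C S))) ⊆ (ballB (coordF C S) ⌊n / M⌋₊ : Finset _) :=
      fun x _ => hball x
    rw [← Set.ncard_univ, ← Set.ncard_coe_finset]
    exact Set.ncard_le_ncard this (Finset.finite_toSet _)
  have hdim : (Module.finrank (ZMod 2) (subcode C S) : ℝ) ≤ n / M * (2 * Real.logb 2 n) := by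
    have h1 : (2:ℝ) ^ Module.finrank (ZMod 2) (subcode C S) ≤ ((n:ℝ) + 1) ^ ⌊n / M⌋₊ := by
      exact_mod_cast hcard
    have h2 := Real.logb_le_logb_of_le (b := 2) (by norm_num) (by positivity) h1
    rw [Real.logb_pow, Real.logb_pow, Real.logb_self_eq_one (by norm_num), mul_one] at h2
    refine h2.trans ?_
    have h3 : Real.logb 2 ((n:ℝ) + 1) ≤ 2 * Real.logb 2 n := by
      have : (2 : ℝ) * Real.logb 2 n = Real.logb 2 ((n:ℝ) ^ 2) := by
        rw [Real.logb_pow]; norm_num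
      rw [this]
      apply Real.logb_le_logb_of_le (by norm_num) (by positivity)
      nlinarith
    have h4 : 0 ≤ Real.logb 2 ((n:ℝ) + 1) := Real.logb_nonneg (by norm_num) (by linarith)
    exact mul_le_mul (Nat.floor_le (by positivity)) h3 h4 (by positivity)
  have hnM : n / M = 4 / (δ * p ^ (q - 2)) := by
    rw [hMdef]; field_simp
  rw [hnM] at hdim
  have h5 : (Module.finrank (ZMod 2) C : ℝ) ≤ S.card + Module.finrank (ZMod 2) (subcode C S) := by
    exact_mod_cast finrank_subcode C S
  linarith

/-- For a `q`-locally correctable code,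
`dim C ≤ O(n^{(q-2)/(q-1)} (log₂ n)^{1/(q-1)})`. -/
theorem LCC_dimension_bound
    (q : ℕ) (hq : 2 ≤ q) (δ : ℝ) (hδ0 : 0 < δ) (hδ1 : δ < 1 / (q : ℝ)) :
    ∃ c : ℝ, 0 < c ∧
      ∀ n : ℕ, 2 ≤ n → ∀ C : Submodule (ZMod 2) (Fin n → ZMod 2),
        IsLocallyCorrectable n q δ C →
        (Module.finrank (ZMod 2) C : ℝ) ≤
          c * (n : ℝ) ^ (((q : ℝ) - 2) / ((q : ℝ) - 1)) *
            (Real.logb 2 (n : ℝ)) ^ ((1 : ℝ) / ((q : ℝ) - 1)) := by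
  have hδ1' : δ < 1 := by
    refine hδ1.trans_le ?_
    rw [div_le_one (by positivity)]
    exact_mod_cast (by omega : 1 ≤ q)
  refine ⟨40 / δ, by positivity, ?_⟩
  intro n hn C hC
  have hn' : (2 : ℝ) ≤ n := by exact_mod_cast hn
  have hn0 : (0 : ℝ) < n := by linarith
  have hq' : (2 : ℝ) ≤ q := by exact_mod_cast hq
  have hq1 : (0 : ℝ) < (q : ℝ) - 1 := by linarith
  set L := Real.logb 2 (n : ℝ) with hL
  have hL1 : 1 ≤ L := by
    rw [hL, Real.le_logb_iff_rpow_le (by norm_num) hn0]; simpa using hn'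
  have hL0 : 0 < L := by linarith
  set t := (L / n) ^ ((1 : ℝ) / ((q : ℝ) - 1)) with ht
  have ht0 : 0 < t := Real.rpow_pos_of_pos (by positivity) _
  have htq : t ^ (q - 1) = L / n := by
    rw [← Real.rpow_natCast, ht, ← Real.rpow_mul (by positivity), Nat.cast_sub (by omega),
      Nat.cast_one, one_div_mul_cancel hq1.ne', Real.rpow_one]
  have hnt : (n : ℝ) ^ (((q : ℝ) - 2) / ((q : ℝ) - 1)) * L ^ ((1 : ℝ) / ((q : ℝ) - 1)) = n * t := by
    rw [ht, Real.div_rpow hL0.le hn0.le,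
      show ((q : ℝ) - 2) / ((q : ℝ) - 1) = 1 - 1 / ((q : ℝ) - 1) by field_simp; ring,
      Real.rpow_sub hn0, Real.rpow_one]
    ring
  rw [mul_assoc, hnt]
  have hq21 : q - 1 = (q - 2) + 1 := by omega
  have hLt : L = n * t * t ^ (q - 2) := by
    have : L = n * t ^ (q - 1) := by rw [htq]; field_simp
    rw [this, hq21, pow_succ]; ring
  have hK1 : 1 ≤ 16 / δ := by rw [le_div_iff₀ hδ0]; linarith
  by_cases hp1 : 16 / δ * t ≤ 1
  · have hp0 : 0 < 16 / δ * t := by positivity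
    have hpow : t ^ (q - 2) ≤ (16 / δ * t) ^ (q - 2) :=
      pow_le_pow_left₀ ht0.le (by nlinarith) _
    have ht2 : 0 < t ^ (q - 2) := pow_pos ht0 _
    have := core_bound q hq δ hδ0 hδ1' n hn C hC (16 / δ * t) hp0 hp1 ?_
    · refine this.trans ?_
      have h1 : 4 / (δ * (16 / δ * t) ^ (q - 2)) * (2 * L) ≤ 4 / (δ * t ^ (q - 2)) * (2 * L) := by
        gcongr
      have h2 : 4 / (δ * t ^ (q - 2)) * (2 * L) = 8 / δ * (n * t) := by
        rw [hLt]; field_simp; ring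
      rw [← hL]
      have h3 : 2 * (16 / δ * t) * n = 32 / δ * (n * t) := by ring
      have h4 : 40 / δ * (n * t) = 32 / δ * (n * t) + 8 / δ * (n * t) := by ring
      linarith
    · have hA : 4 * L ≤ δ * n * (16 / δ * t) ^ (q - 2) / 4 := by
        have h1 : 16 * L ≤ δ * n * (16 / δ * t) ^ (q - 2) := by
          calc 16 * L = δ * n * t ^ (q - 2) * (16 / δ * t) := by rw [hLt]; field_simp
            _ ≤ δ * n * t ^ (q - 2) * 1 := by gcongr
            _ = δ * n * t ^ (q - 2) := mul_one _
            _ ≤ _ := by gcongr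
        linarith
      have hlog : Real.log n ≤ L := by
        rw [hL, Real.logb, le_div_iff₀ (Real.log_pos (by norm_num))]
        have h1 : 0 ≤ Real.log n := Real.log_nonneg (by linarith)
        have h2 : Real.log 2 ≤ 1 := by have := Real.log_two_lt_d9; linarith
        nlinarith
      have h5 : Real.exp (-(δ * n * (16 / δ * t) ^ (q - 2) / 4)) ≤ ((n : ℝ) ^ 4)⁻¹ := by
        have : ((n : ℝ) ^ 4)⁻¹ = Real.exp (-(4 * Real.log n)) := by
          rw [Real.exp_neg, mul_comm, Real.exp_mul, Real.exp_log hn0]; norm_cast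
        rw [this]
        apply Real.exp_le_exp.2
        linarith
      calc n * Real.exp (-(δ * n * (16 / δ * t) ^ (q - 2) / 4)) ≤ n * ((n : ℝ) ^ 4)⁻¹ := by gcongr
        _ = ((n : ℝ) ^ 3)⁻¹ := by field_simp
        _ ≤ ((2 : ℝ) ^ 3)⁻¹ := by gcongr
        _ < 1 / 2 := by norm_num
  · push Not at hp1
    have h1 : (Module.finrank (ZMod 2) C : ℝ) ≤ n := by
      have := Submodule.finrank_le C
      rw [Module.finrank_pi, Fintype.card_fin] at this
      exact_mod_cast this
    have h2 : 40 / δ * (n * t) = n * (16 / δ * t) + 24 / δ * (n * t) := by ring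
    have h3 : 0 ≤ 24 / δ * (n * t) := by positivity
    nlinarith
end

section
/- Let C ⊆ F₂ⁿ be a 2-locally correctable code with density δ (0 < δ < 1/2, and δn ≥ 1). Then the covering radius of C^⊥ is at most 1/δ, and dim C ≤ (log₂(δn+1) + 1/ln 2)/δ. -/
namespace LCCaux

/-- the dual as a submodule -/
def dualSub {n : ℕ} (C : Submodule (ZMod 2) (Fin n → ZMod 2)) :
    Submodule (ZMod 2) (Fin n → ZMod 2) where
  carrier := dualSet (C : Set (Fin n → ZMod 2))
  add_mem' := by
    intro a b ha hb x hx
    have h1 := ha x hx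
    have h2 := hb x hx
    simp only [Pi.add_apply, mul_add, Finset.sum_add_distrib, h1, h2, add_zero]
  zero_mem' := by
    intro x hx
    simp
  smul_mem' := by
    intro c a ha x hx
    have h1 := ha x hx
    simp only [Pi.smul_apply, smul_eq_mul]
    have : ∀ i, x i * (c * a i) = c * (x i * a i) := fun i => by ring
    simp only [this, ← Finset.mul_sum, h1, mul_zero]

/-- coset weight -/
noncomputable def cw {n : ℕ} (D : Submodule (ZMod 2) (Fin n → ZMod 2))
    (x : Fin n → ZMod 2) : ℕ :=
  sInf {k | ∃ y ∈ D, hammingNorm (x + y) = k}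

variable {n : ℕ} (D : Submodule (ZMod 2) (Fin n → ZMod 2))

lemma cw_le (x : Fin n → ZMod 2) {y : Fin n → ZMod 2} (hy : y ∈ D) :
    cw D x ≤ hammingNorm (x + y) := Nat.sInf_le ⟨y, hy, rfl⟩

lemma cw_exists (x : Fin n → ZMod 2) : ∃ y ∈ D, hammingNorm (x + y) = cw D x :=
  Nat.sInf_mem (s := {k | ∃ y ∈ D, hammingNorm (x + y) = k}) ⟨_, 0, D.zero_mem, rfl⟩

lemma norm_add_le (a b : Fin n → ZMod 2) :
    hammingNorm (a + b) ≤ hammingNorm a + hammingNorm b := by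
  have h := hammingDist_triangle a 0 (-b)
  rw [hammingDist_eq_hammingNorm, hammingDist_eq_hammingNorm, hammingDist_eq_hammingNorm] at h
  have e : ∀ v : Fin n → ZMod 2, -v = v := fun v => by
    ext i; exact ZMod.neg_eq_self_mod_two _
  simpa [e] using h

lemma cw_add (a b : Fin n → ZMod 2) : cw D (a + b) ≤ cw D a + cw D b := by
  obtain ⟨y, hy, h1⟩ := cw_exists D a
  obtain ⟨z, hz, h2⟩ := cw_exists D b
  have h := cw_le D (a + b) (D.add_mem hy hz)
  have h3 := norm_add_le (a + y) (b + z)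
  rw [show a + y + (b + z) = a + b + (y + z) by abel] at h3
  omega

lemma vadd_self (a : Fin n → ZMod 2) : a + a = 0 := by
  ext i; exact CharTwo.add_self_eq_zero _

lemma cw_mem {a : Fin n → ZMod 2} (h : a ∈ D) : cw D a = 0 := by
  have := cw_le D a h
  rw [vadd_self, hammingNorm_zero] at this
  omega

lemma cw_single (i : Fin n) : cw D (Pi.single i 1) ≤ 1 := by
  have h := cw_le D (Pi.single i 1) D.zero_mem
  rw [add_zero] at h
  refine h.trans ?_
  unfold hammingNorm
  refine Finset.card_le_one.2 ?_
  intro a ha b hb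
  simp [Pi.single_apply] at ha hb
  rw [ha, hb]

lemma zmod2_ne {a : ZMod 2} (h : a ≠ 0) : a = 1 := by
  revert a; decide

/-- single step -/
lemma step (C : Submodule (ZMod 2) (Fin n → ZMod 2)) (δ : ℝ) (hδ1 : δ < 1 / 2)
    (hC : IsLocallyCorrectable n 2 δ C) (i : Fin n) :
    ∃ g : Equiv.Perm (Fin n),
      ∑ j, (cw (dualSub C) (Pi.single i 1 + Pi.single j 1 + Pi.single (g j) 1) : ℝ)
        ≤ n * (1 - 2 * δ) := by
  classical
  rcases hC i with h | ⟨F, hF, hF1, hF2⟩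
  · refine ⟨1, ?_⟩
    have : ∀ j, cw (dualSub C) (Pi.single i 1 + Pi.single j 1
        + Pi.single ((1 : Equiv.Perm (Fin n)) j) 1) = 0 := by
      intro j
      rw [Equiv.Perm.one_apply, add_assoc, vadd_self, add_zero]
      exact cw_mem _ h
    simp only [this, Nat.cast_zero, Finset.sum_const_zero]
    have : (0 : ℝ) ≤ n := Nat.cast_nonneg n
    nlinarith
  · set T : (Fin n → ZMod 2) → Finset (Fin n) :=
      fun y => (Finset.univ.filter (fun j => y j ≠ 0)).erase i with hT
    have hTc : ∀ y ∈ F, (T y).card = 2 := by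
      intro y hy
      obtain ⟨-, h2, h3⟩ := hF1 y hy
      have h4 : (Finset.univ.filter (fun j => y j ≠ 0)).card = 3 := h2
      have : i ∈ Finset.univ.filter (fun j => y j ≠ 0) := by simp [h3]
      simp only [hT]
      rw [Finset.card_erase_of_mem this, h4]
    have hmT : ∀ y j, j ∈ T y ↔ j ≠ i ∧ y j ≠ 0 := by
      intro y j; simp [hT]
    have hdisj : ∀ y ∈ F, ∀ z ∈ F, ∀ j, j ∈ T y → j ∈ T z → y = z := by
      intro y hy z hz j h1 h2
      by_contra hne
      exact hF2 y hy z hz hne j ((hmT y j).1 h1).1 ⟨((hmT y j).1 h1).2, ((hmT z j).1 h2).2⟩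
    set A : Finset (Fin n) := F.biUnion T with hA
    have hAc : A.card = 2 * F.card := by
      rw [hA, Finset.card_biUnion, Finset.sum_congr rfl hTc]
      · simp [mul_comm]
      · intro y hy z hz hne
        show Disjoint (T y) (T z)
        rw [Finset.disjoint_left]
        intro j h1 h2
        exact hne (hdisj y hy z hz j h1 h2)
    let P : Fin n → Fin n → Prop := fun j k => ∃ y ∈ F, j ∈ T y ∧ k ∈ T y ∧ j ≠ k
    have hPs : ∀ j k, P j k → P k j := by
      rintro j k ⟨y, hy, h1, h2, h3⟩
      exact ⟨y, hy, h2, h1, h3.symm⟩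
    have hPf : ∀ j k l, P j k → P j l → k = l := by
      rintro j k l ⟨y, hy, h1, h2, h3⟩ ⟨z, hz, h4, h5, h6⟩
      obtain rfl := hdisj y hy z hz j h1 h4
      obtain ⟨a, b, hab, he⟩ := Finset.card_eq_two.1 (hTc y hy)
      rw [he] at h1 h2 h5
      simp only [Finset.mem_insert, Finset.mem_singleton] at h1 h2 h5
      grind
    have hPA : ∀ j ∈ A, ∃ k, P j k := by
      intro j hj
      obtain ⟨y, hy, h1⟩ := Finset.mem_biUnion.1 hj
      obtain ⟨k, hk, hne⟩ := Finset.exists_mem_ne (by rw [hTc y hy]; norm_num : 1 < (T y).card) j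
      exact ⟨k, y, hy, h1, hk, hne.symm⟩
    have hPA' : ∀ j k, P j k → j ∈ A := by
      rintro j k ⟨y, hy, h1, -⟩
      exact Finset.mem_biUnion.2 ⟨y, hy, h1⟩
    have hPD : ∀ j k, P j k →
        (Pi.single i 1 + Pi.single j 1 + Pi.single k 1 : Fin n → ZMod 2) ∈ dualSub C := by
      rintro j k ⟨y, hy, h1, h2, h3⟩
      have hTe : ∀ l, l ∈ T y ↔ l = j ∨ l = k := by
        obtain ⟨a, b, hab, he⟩ := Finset.card_eq_two.1 (hTc y hy)
        rw [he] at h1 h2 ⊢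
        simp only [Finset.mem_insert, Finset.mem_singleton] at h1 h2 ⊢
        grind
      have hyD : y ∈ dualSub C := (hF1 y hy).1
      have hyi := zmod2_ne (hF1 y hy).2.2
      have hj := (hmT y j).1 h1
      have hk := (hmT y k).1 h2
      have hj1 := zmod2_ne hj.2
      have hk1 := zmod2_ne hk.2
      convert hyD using 1
      ext l
      simp only [Pi.add_apply, Pi.single_apply]
      have h4 := hmT y l
      rw [hTe l] at h4
      by_cases hli : l = i
      · subst hli
        rw [if_pos rfl, if_neg (Ne.symm hj.1), if_neg (Ne.symm hk.1), hyi]; simp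
      · by_cases hlj : l = j
        · subst hlj
          rw [if_neg hli, if_pos rfl, if_neg h3, hj1]; simp
        · by_cases hlk : l = k
          · subst hlk
            rw [if_neg hli, if_neg hlj, if_pos rfl, hk1]; simp
          · rw [if_neg hli, if_neg hlj, if_neg hlk]
            by_contra h5
            have := h4.2 ⟨hli, fun h => h5 (by rw [h]; simp)⟩
            tauto
    let g : Fin n → Fin n := fun j => if h : ∃ k, P j k then h.choose else j
    have hg1 : ∀ j, (∃ k, P j k) → P j (g j) := by
      intro j h
      simp only [g, dif_pos h]
      exact h.choose_spec
    have hg2 : ∀ j, ¬ (∃ k, P j k) → g j = j := by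
      intro j h
      simp only [g, dif_neg h]
    have hinv : Function.Involutive g := by
      intro j
      by_cases h : ∃ k, P j k
      · have h1 := hPs _ _ (hg1 j h)
        exact hPf _ _ _ (hg1 (g j) ⟨j, h1⟩) h1
      · rw [hg2 j h, hg2 j h]
    refine ⟨hinv.toPerm g, ?_⟩
    have hb : ∀ j, (cw (dualSub C) (Pi.single i 1 + Pi.single j 1
        + Pi.single ((hinv.toPerm g) j) 1) : ℝ) ≤ 1 - (if j ∈ A then 1 else 0) := by
      intro j
      rw [Function.Involutive.coe_toPerm]
      by_cases hj : j ∈ A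
      · rw [if_pos hj, cw_mem _ (hPD _ _ (hg1 j (hPA j hj)))]; simp
      · rw [if_neg hj, hg2 j (fun ⟨k, hk⟩ => hj (hPA' j k hk)), add_assoc, vadd_self, add_zero,
          sub_zero]
        exact_mod_cast cw_single _ i
    refine (Finset.sum_le_sum (fun j _ => hb j)).trans ?_
    rw [Finset.sum_sub_distrib]
    simp only [Finset.sum_const, Finset.card_univ, Fintype.card_fin, nsmul_eq_mul, mul_one,
      Finset.sum_ite_mem, Finset.univ_inter, hAc]
    push_cast
    linarith

lemma steps (C : Submodule (ZMod 2) (Fin n → ZMod 2)) (δ : ℝ) (hδ1 : δ < 1 / 2)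
    (hC : IsLocallyCorrectable n 2 δ C) (S : Finset (Fin n)) :
    ∃ g : Equiv.Perm (Fin n),
      ∑ j, (cw (dualSub C) ((∑ i ∈ S, Pi.single i 1) + Pi.single j 1 + Pi.single (g j) 1) : ℝ)
        ≤ S.card * (n * (1 - 2 * δ)) := by
  classical
  induction S using Finset.induction_on with
  | empty =>
    refine ⟨1, ?_⟩
    simp only [Finset.sum_empty, Equiv.Perm.one_apply, zero_add, vadd_self,
      cw_mem _ (Submodule.zero_mem _)]
    simp
  | insert i S hi ih =>
    obtain ⟨σ, hσ⟩ := ih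
    obtain ⟨g, hg⟩ := step C δ hδ1 hC i
    refine ⟨σ.trans g, ?_⟩
    rw [← Equiv.sum_comp σ] at hg
    rw [Finset.card_insert_of_notMem hi]
    push_cast
    have : ∀ j, (cw (dualSub C) ((∑ i ∈ insert i S, Pi.single i 1) + Pi.single j 1
        + Pi.single ((σ.trans g) j) 1) : ℝ) ≤
        cw (dualSub C) ((∑ i ∈ S, Pi.single i 1) + Pi.single j 1 + Pi.single (σ j) 1)
        + cw (dualSub C) (Pi.single i 1 + Pi.single (σ j) 1 + Pi.single (g (σ j)) 1) := by
      intro j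
      have h := cw_add (dualSub C)
        ((∑ i ∈ S, Pi.single i 1) + Pi.single j 1 + Pi.single (σ j) 1)
        (Pi.single i 1 + Pi.single (σ j) 1 + Pi.single (g (σ j)) 1)
      rw [Finset.sum_insert hi, Equiv.trans_apply]
      have e : ((∑ i ∈ S, Pi.single i 1) + Pi.single j 1 + Pi.single (σ j) 1 : Fin n → ZMod 2) +
        (Pi.single i 1 + Pi.single (σ j) 1 + Pi.single (g (σ j)) 1) =
        (Pi.single i 1 + ∑ i ∈ S, Pi.single i 1) + Pi.single j 1
          + Pi.single (g (σ j)) (1 : ZMod 2) + (Pi.single (σ j) 1 + Pi.single (σ j) 1) := by abel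
      rw [e, vadd_self, add_zero] at h
      exact_mod_cast h
    refine (Finset.sum_le_sum (fun j _ => this j)).trans ?_
    rw [Finset.sum_add_distrib]
    linarith

lemma covering (C : Submodule (ZMod 2) (Fin n → ZMod 2)) (δ : ℝ) (hδ0 : 0 < δ) (hδ1 : δ < 1 / 2)
    (hn : 0 < n) (hC : IsLocallyCorrectable n 2 δ C) (x : Fin n → ZMod 2) :
    ∃ y ∈ dualSub C, (hammingNorm (x + y) : ℝ) ≤ 1 / δ := by
  classical
  obtain ⟨y, hy, h⟩ := cw_exists (dualSub C) x
  refine ⟨y, hy, ?_⟩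
  set z := x + y with hz
  set S := Finset.univ.filter (fun j => z j ≠ 0) with hS
  have hSc : S.card = hammingNorm z := rfl
  have hsum : ∑ i ∈ S, Pi.single i (1 : ZMod 2) = z := by
    ext j
    rw [Finset.sum_apply]
    simp only [Pi.single_apply, Finset.sum_ite_eq, hS, Finset.mem_filter, Finset.mem_univ,
      true_and]
    split_ifs with h1
    · exact (zmod2_ne h1).symm
    · push Not at h1; exact h1.symm
  obtain ⟨g, hg⟩ := steps C δ hδ1 hC S
  rw [hsum, hSc] at hg
  have hb : ∀ j, (hammingNorm z : ℝ) - 2 ≤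
      cw (dualSub C) (z + Pi.single j 1 + Pi.single (g j) 1) := by
    intro j
    have h1 := cw_add (dualSub C) z y
    rw [cw_mem _ hy, hz, add_assoc, vadd_self, add_zero, ← hz, ← h] at h1
    have h2 := cw_add (dualSub C) (z + Pi.single j 1 + Pi.single (g j) 1)
      (Pi.single j 1 + Pi.single (g j) 1)
    have h3 := cw_add (dualSub C) (Pi.single j 1) (Pi.single (g j) 1)
    have h4 := cw_single (dualSub C) j
    have h5 := cw_single (dualSub C) (g j)
    rw [add_assoc z, add_assoc z, vadd_self, add_zero, ← add_assoc z] at h2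
    have : hammingNorm z ≤ cw (dualSub C) (z + Pi.single j 1 + Pi.single (g j) 1) + 2 := by omega
    have : (hammingNorm z : ℝ) ≤ cw (dualSub C) (z + Pi.single j 1 + Pi.single (g j) 1) + 2 := by
      exact_mod_cast this
    linarith
  have h6 := (Finset.sum_le_sum (fun j (_ : j ∈ Finset.univ) => hb j)).trans hg
  simp only [Finset.sum_const, Finset.card_univ, Fintype.card_fin, nsmul_eq_mul] at h6
  have hn' : (0 : ℝ) < n := by exact_mod_cast hn
  rw [le_div_iff₀ hδ0]
  have : (n : ℝ) * (hammingNorm z * δ) ≤ n * 1 := by nlinarith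
  exact le_of_mul_le_mul_left this hn'

lemma sum_pow_norm (t : ℝ) : ∑ x : Fin n → ZMod 2, t ^ hammingNorm x = (1 + t) ^ n := by
  classical
  have h : ∀ x : Fin n → ZMod 2, t ^ hammingNorm x = ∏ i, (if x i ≠ 0 then t else 1) := by
    intro x
    rw [← Finset.prod_filter, Finset.prod_const]
    rfl
  simp only [h]
  have := Finset.prod_univ_sum (fun _ : Fin n => (Finset.univ : Finset (ZMod 2)))
    (fun _ a => if a ≠ 0 then t else (1 : ℝ))
  rw [Fintype.piFinset_univ] at this
  rw [← this]
  have h2 : ∑ a : ZMod 2, (if a ≠ 0 then t else (1 : ℝ)) = 1 + t := by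
    rw [show (Finset.univ : Finset (ZMod 2)) = {0, 1} by decide,
      Finset.sum_pair (by decide)]
    simp
  rw [h2]; simp

lemma ball_card (C : Submodule (ZMod 2) (Fin n → ZMod 2)) (R : ℝ)
    (h : ∀ x, ∃ y ∈ dualSub C, (hammingNorm (x + y) : ℝ) ≤ R) :
    2 ^ Module.finrank (ZMod 2) C ≤
      Fintype.card {x : Fin n → ZMod 2 // (hammingNorm x : ℝ) ≤ R} := by
  classical
  have hcard : Nat.card (Module.Dual (ZMod 2) C) = 2 ^ Module.finrank (ZMod 2) C := by
    rw [Module.natCard_eq_pow_finrank (K := ZMod 2), Subspace.dual_finrank_eq, Nat.card_zmod]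
  rw [← hcard, ← Nat.card_eq_fintype_card]
  let φ : {x : Fin n → ZMod 2 // (hammingNorm x : ℝ) ≤ R} → Module.Dual (ZMod 2) C :=
    fun x => ((dotProductEquiv (ZMod 2) (Fin n)) x.1).comp C.subtype
  refine Nat.card_le_card_of_surjective φ ?_
  intro f
  obtain ⟨f', hf'⟩ := LinearMap.exists_extend f
  obtain ⟨x, hx⟩ := (dotProductEquiv (ZMod 2) (Fin n)).surjective f'
  obtain ⟨y, hy, hxy⟩ := h x
  refine ⟨⟨x + y, hxy⟩, ?_⟩
  ext c
  have h0 : ∑ i, c.1 i * y i = 0 := hy c.1 c.2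
  have h1 : f' c.1 = f c := by rw [← hf']; rfl
  have h2 : (dotProductEquiv (ZMod 2) (Fin n)) y c.1 = 0 := by
    rw [← h0]
    simp [dotProduct, mul_comm]
  simp only [φ, map_add, LinearMap.comp_apply, Submodule.subtype_apply, LinearMap.add_apply]
  rw [h2, hx, add_zero, h1]

lemma dim_bound (C : Submodule (ZMod 2) (Fin n → ZMod 2)) (δ : ℝ) (hδ0 : 0 < δ)
    (hδn : 1 ≤ δ * n)
    (h : ∀ x, ∃ y ∈ dualSub C, (hammingNorm (x + y) : ℝ) ≤ 1 / δ) :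
    (Module.finrank (ZMod 2) C : ℝ) ≤ (Real.logb 2 (δ * n + 1) + 1 / Real.log 2) / δ := by
  classical
  have h1 := ball_card C (1 / δ) h
  set N := Fintype.card {x : Fin n → ZMod 2 // (hammingNorm x : ℝ) ≤ 1 / δ} with hN
  have hp : 0 < δ * n := by linarith
  set t : ℝ := 1 / (δ * n) with ht
  have ht0 : 0 < t := by positivity
  have ht1 : t ≤ 1 := by rw [ht, div_le_one hp]; exact hδn
  have h2 : (N : ℝ) * t ^ (1 / δ : ℝ) ≤ (1 + t) ^ n := by
    rw [← sum_pow_norm, hN, Fintype.card_subtype, ← nsmul_eq_mul, ← Finset.sum_const]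
    refine le_trans (Finset.sum_le_sum (g := fun x => t ^ hammingNorm x) ?_)
      (Finset.sum_le_sum_of_subset_of_nonneg (Finset.subset_univ _) ?_)
    · intro x hx
      rw [← Real.rpow_natCast]
      exact Real.rpow_le_rpow_of_exponent_ge ht0 ht1 (Finset.mem_filter.1 hx).2
    · intro x _ _
      positivity
  have h3 : (1 + t) ^ n ≤ Real.exp (1 / δ) := by
    have h4 : 1 + t ≤ Real.exp t := by linarith [Real.add_one_le_exp t]
    have hn0 : (n : ℝ) ≠ 0 := fun h => by rw [h] at hp; simp at hp
    have h5 : (n : ℝ) * t = 1 / δ := by rw [ht]; field_simp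
    rw [← h5, Real.exp_nat_mul]
    exact pow_le_pow_left₀ (by positivity) h4 n
  have h6 : (2 : ℝ) ^ Module.finrank (ZMod 2) C * t ^ (1 / δ : ℝ) ≤ Real.exp (1 / δ) := by
    refine le_trans ?_ (h2.trans h3)
    gcongr
    exact_mod_cast h1
  have h7 := Real.log_le_log (by positivity) h6
  rw [Real.log_exp, Real.log_mul (by positivity) (by positivity), Real.log_pow,
    Real.log_rpow ht0, ht, one_div (δ * n), Real.log_inv] at h7
  have h8 : Real.log (δ * n) ≤ Real.log (δ * n + 1) := Real.log_le_log hp (by linarith)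
  have hl : 0 < Real.log 2 := Real.log_pos (by norm_num)
  rw [Real.logb, ← add_div, div_div, le_div_iff₀ (by positivity)]
  have h9 : (1 / δ * -Real.log (δ * n)) * δ = -Real.log (δ * n) := by field_simp
  have h10 : 1 / δ * δ = 1 := by field_simp
  nlinarith

end LCCaux

/-- For a `2`-locally correctable code with density `δ`: the covering radius of `C^⊥`
is at most `1/δ`, and `dim C ≤ (log₂(δn+1) + 1/ln 2)/δ`. -/
theorem LCC_q_two
    (n : ℕ) (δ : ℝ) (hδ0 : 0 < δ) (hδ1 : δ < 1 / 2) (hδn : 1 ≤ δ * n)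
    (C : Submodule (ZMod 2) (Fin n → ZMod 2))
    (hC : IsLocallyCorrectable n 2 δ C) :
    (∀ x : Fin n → ZMod 2, ∃ y ∈ dualSet (C : Set (Fin n → ZMod 2)),
        (hammingDist x y : ℝ) ≤ 1 / δ) ∧
      (Module.finrank (ZMod 2) C : ℝ) ≤ (Real.logb 2 (δ * n + 1) + 1 / Real.log 2) / δ := by
  have hn : 0 < n := by
    rcases Nat.eq_zero_or_pos n with h | h
    · subst h; norm_num at hδn
    · exact h
  have hcov := LCCaux.covering C δ hδ0 hδ1 hn hC
  refine ⟨?_, LCCaux.dim_bound C δ hδ0 hδn hcov⟩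
  intro x
  obtain ⟨y, hy, h⟩ := hcov x
  refine ⟨y, hy, ?_⟩
  rw [hammingDist_eq_hammingNorm]
  have hneg : -x = x := by
    ext i; exact ZMod.neg_eq_self_mod_two _
  rw [hneg]
  exact h
end

section
/- There exists an absolute constant c > 0 such that for every n ≥ 1 and every perfect 3-locally correctable code C ⊆ F₂ⁿ, the dimension of C satisfies dim C ≤ c·√n. -/
/-- `C` is a perfect 3-locally correctable code: `n ≡ 1 (mod 3)` and for every
coordinate `i` there is a partition of `{1,…,n}∖{i}` into `(n-1)/3` three-element
sets `α` with `eᵢ + Σ_{j∈α} eⱼ ∈ C^⊥`. -/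
def IsPerfect3LCC (n : ℕ) (C : Submodule (ZMod 2) (Fin n → ZMod 2)) : Prop :=
  n % 3 = 1 ∧
  ∀ i : Fin n, ∃ P : Finset (Finset (Fin n)),
    P.card = (n - 1) / 3 ∧
    (∀ α ∈ P, α.card = 3) ∧
    (P : Set (Finset (Fin n))).PairwiseDisjoint id ∧
    (∀ α ∈ P, i ∉ α) ∧
    (∀ j : Fin n, j ≠ i → ∃ α ∈ P, j ∈ α) ∧
    (∀ α ∈ P, (Pi.single i 1 + ∑ j ∈ α, Pi.single j (1 : ZMod 2)) ∈
      dualSet (C : Set (Fin n → ZMod 2)))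

namespace LCCProof

open Classical in
/-- Coordinates vanishing on `D`. -/
noncomputable def Z {n : ℕ} (D : Set (Fin n → ZMod 2)) : Finset (Fin n) :=
  Finset.univ.filter fun i => ∀ x ∈ D, x i = 0

open Classical in
/-- Coordinates agreeing with coordinate `a` on `D`. -/
noncomputable def cls {n : ℕ} (D : Set (Fin n → ZMod 2)) (a : Fin n) : Finset (Fin n) :=
  Finset.univ.filter fun c => ∀ x ∈ D, x c = x a

/-- The truncated logarithmic potential of a coordinate at level `a`. -/
noncomputable def g {n : ℕ} (a : ℕ) (D : Set (Fin n → ZMod 2)) (j : Fin n) : ℕ :=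
  if j ∈ Z D then a + 2 else min (Nat.log 2 (cls D j).card) (a + 2)

lemma mem_Z {n : ℕ} {D : Set (Fin n → ZMod 2)} {i : Fin n} :
    i ∈ Z D ↔ ∀ x ∈ D, x i = 0 := by simp [Z]

lemma mem_cls {n : ℕ} {D : Set (Fin n → ZMod 2)} {a c : Fin n} :
    c ∈ cls D a ↔ ∀ x ∈ D, x c = x a := by simp [cls]

lemma card_cls_pos {n : ℕ} (D : Set (Fin n → ZMod 2)) (a : Fin n) : 0 < (cls D a).card :=
  Finset.card_pos.mpr ⟨a, mem_cls.mpr fun _ _ => rfl⟩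

lemma g_le {n : ℕ} (a : ℕ) (D : Set (Fin n → ZMod 2)) (j : Fin n) : g a D j ≤ a + 2 := by
  unfold g; split_ifs <;> simp

lemma g_mono {n : ℕ} (a : ℕ) {D D' : Set (Fin n → ZMod 2)} (h : D' ⊆ D) (j : Fin n) :
    g a D j ≤ g a D' j := by
  by_cases hj' : j ∈ Z D'
  · have : g a D' j = a + 2 := by simp [g, hj']
    rw [this]; exact g_le a D j
  · have hj : j ∉ Z D := fun hj => hj' (mem_Z.mpr fun x hx => mem_Z.mp hj x (h hx))
    simp only [g, hj, hj', if_false]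
    have : (cls D j).card ≤ (cls D' j).card :=
      Finset.card_le_card fun c hc => mem_cls.mpr fun x hx => mem_cls.mp hc x (h hx)
    exact min_le_min_right _ (Nat.log_mono_right this)

/-- The smaller of two merging classes gains at least one. -/
lemma g_merge {n : ℕ} (a : ℕ) {D : Set (Fin n → ZMod 2)} {b q r : Fin n}
    (hb : b ∉ Z D) (hq : q ∉ Z D) (hqa : Nat.log 2 (cls D q).card ≤ a)
    (hrel : ∀ x ∈ D, x b = x q + x r) (hle : (cls D q).card ≤ (cls D r).card) :
    g a D q + 1 ≤ g a {x ∈ D | x b = 0} q := by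
  set D' := {x ∈ D | x b = 0} with hD'
  have h1 : g a D q ≤ Nat.log 2 (cls D q).card := by simp [g, hq]
  by_cases hq' : q ∈ Z D'
  · have : g a D' q = a + 2 := by simp [g, hq']
    omega
  have hdis : Disjoint (cls D q) (cls D r) := by
    rw [Finset.disjoint_left]
    intro c hc hc'
    apply hb
    rw [mem_Z]
    intro x hx
    rw [hrel x hx, ← mem_cls.mp hc x hx, ← mem_cls.mp hc' x hx]
    exact CharTwo.add_self_eq_zero _
  have hsub : cls D q ∪ cls D r ⊆ cls D' q := by
    intro c hc
    rw [mem_cls]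
    rintro x ⟨hx, hxb⟩
    rcases Finset.mem_union.mp hc with hc | hc
    · exact mem_cls.mp hc x hx
    · rw [mem_cls.mp hc x hx]
      have := hrel x hx
      rw [hxb] at this
      exact (CharTwo.add_eq_zero.mp this.symm).symm
  have hcard := Finset.card_le_card hsub
  rw [Finset.card_union_of_disjoint hdis] at hcard
  have hpos := card_cls_pos D q
  have h2 : Nat.log 2 (cls D q).card + 1 ≤ Nat.log 2 (cls D' q).card := by
    rw [← Nat.log_mul_base (by norm_num) hpos.ne']
    exact Nat.log_mono_right (by omega)
  have h3 : g a D' q = min (Nat.log 2 (cls D' q).card) (a + 2) := by simp [g, hq']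
  rw [h3]
  apply le_min <;> omega

/-- Gain on a triple with first element in `Z D`. -/
lemma triple_aux {n : ℕ} (a : ℕ) {D : Set (Fin n → ZMod 2)} {b p q r : Fin n}
    (hb : b ∉ Z D) (hmax : ∀ i, i ∉ Z D → Nat.log 2 (cls D i).card ≤ a)
    (hrel : ∀ x ∈ D, x b = x p + x q + x r) (hp : p ∈ Z D) :
    g a D p + g a D q + g a D r + (1 + (if q ∈ Z D then 1 else 0) + (if r ∈ Z D then 1 else 0)) ≤
      g a {x ∈ D | x b = 0} p + g a {x ∈ D | x b = 0} q + g a {x ∈ D | x b = 0} r := by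
  set D' := {x ∈ D | x b = 0} with hD'
  have hsub : D' ⊆ D := fun x hx => hx.1
  have mp := g_mono a hsub p
  have mq := g_mono a hsub q
  have mr := g_mono a hsub r
  have hrel' : ∀ x ∈ D, x b = x q + x r := by
    intro x hx
    rw [hrel x hx, mem_Z.mp hp x hx, zero_add]
  have two : ∀ q r : Fin n, q ∈ Z D → r ∉ Z D → (∀ x ∈ D, x b = x q + x r) →
      g a D r + 2 ≤ g a D' r := by
    intro q r hq hr h
    have hr' : r ∈ Z D' := by
      rw [mem_Z]
      rintro x ⟨hx, hxb⟩
      have := h x hx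
      rw [hxb, mem_Z.mp hq x hx, zero_add] at this
      exact this.symm
    have h1 : g a D r ≤ Nat.log 2 (cls D r).card := by simp [g, hr]
    have h2 : g a D' r = a + 2 := by simp [g, hr']
    have := hmax r hr
    omega
  have hrel2 : ∀ x ∈ D, x b = x r + x q := fun x hx => by rw [hrel' x hx, add_comm]
  by_cases hq : q ∈ Z D <;> by_cases hr : r ∈ Z D
  · exact absurd (mem_Z.mpr fun x hx => by
      rw [hrel' x hx, mem_Z.mp hq x hx, mem_Z.mp hr x hx, zero_add]) hb
  · have := two q r hq hr hrel'
    simp only [hq, hr, if_true, if_false]; omega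
  · have := two r q hr hq hrel2
    simp only [hq, hr, if_true, if_false]; omega
  · simp only [hq, hr, if_false]
    rcases le_total (cls D q).card (cls D r).card with h | h
    · have := g_merge a hb hq (hmax q hq) hrel' h
      rw [← hD'] at this
      omega
    · have := g_merge a hb hr (hmax r hr) hrel2 h
      rw [← hD'] at this
      omega

lemma triple {n : ℕ} (a : ℕ) {D : Set (Fin n → ZMod 2)} {b : Fin n}
    (hb : b ∉ Z D) (hmax : ∀ i, i ∉ Z D → Nat.log 2 (cls D i).card ≤ a)
    (α : Finset (Fin n)) (hα : α.card = 3)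
    (hrel : ∀ x ∈ D, x b = ∑ j ∈ α, x j) :
    ∑ j ∈ α, (g a D j + if j ∈ Z D then 1 else 0) ≤ ∑ j ∈ α, g a {x ∈ D | x b = 0} j := by
  obtain ⟨p, q, r, hpq, hpr, hqr, rfl⟩ := Finset.card_eq_three.mp hα
  have sum3 : ∀ {M : Type} [AddCommMonoid M] (f : Fin n → M),
      ∑ j ∈ ({p, q, r} : Finset (Fin n)), f j = f p + f q + f r := by
    intro M _ f
    rw [Finset.sum_insert (by simp [hpq, hpr]), Finset.sum_pair hqr, add_assoc]
  rw [sum3, sum3]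
  have hrel0 : ∀ x ∈ D, x b = x p + x q + x r := fun x hx => by rw [hrel x hx, sum3]
  by_cases hp : p ∈ Z D
  · have := triple_aux a hb hmax hrel0 hp
    simp only [hp, if_true]; omega
  by_cases hq : q ∈ Z D
  · have := triple_aux (p := q) (q := p) (r := r) a hb hmax
      (fun x hx => by rw [hrel0 x hx]; ring) hq
    simp only [hp, hq, if_true, if_false] at this ⊢; omega
  by_cases hr : r ∈ Z D
  · have := triple_aux (p := r) (q := p) (r := q) a hb hmax
      (fun x hx => by rw [hrel0 x hx]; ring) hr
    simp only [hp, hq, hr, if_true, if_false] at this ⊢; omega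
  have hsub : {x ∈ D | x b = 0} ⊆ D := fun x hx => hx.1
  have mp := g_mono a hsub p
  have mq := g_mono a hsub q
  have mr := g_mono a hsub r
  simp only [hp, hq, hr, if_false]; omega

/-- Potential gain in one step. -/
lemma step_gain {n : ℕ} {C : Submodule (ZMod 2) (Fin n → ZMod 2)} (hC : IsPerfect3LCC n C)
    (a : ℕ) {D : Set (Fin n → ZMod 2)} (hD : D ⊆ C) {b : Fin n}
    (hb : b ∉ Z D) (hmax : ∀ i, i ∉ Z D → Nat.log 2 (cls D i).card ≤ a) :
    ∑ j, g a D j + (Z D).card ≤ ∑ j, g a {x ∈ D | x b = 0} j := by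
  obtain ⟨P, -, h3, hdis, hi, hcov, hdual⟩ := hC.2 b
  have hU : (Finset.univ : Finset (Fin n)) = insert b (P.biUnion id) := by
    ext j
    simp only [Finset.mem_univ, Finset.mem_insert, Finset.mem_biUnion, id, true_iff]
    by_cases h : j = b
    · exact Or.inl h
    · exact Or.inr (hcov j h)
  have hnb : b ∉ P.biUnion id := by
    simp only [Finset.mem_biUnion, id, not_exists, not_and]
    exact hi
  have hcard : (Z D).card = ∑ j, if j ∈ Z D then 1 else 0 := by simp
  rw [hcard, ← Finset.sum_add_distrib, hU, Finset.sum_insert hnb, Finset.sum_insert hnb,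
    Finset.sum_biUnion hdis, Finset.sum_biUnion hdis]
  have hbb := g_mono a (D := D) (D' := {x ∈ D | x b = 0}) (fun x hx => hx.1) b
  simp only [hb, if_false, add_zero]
  refine add_le_add hbb (Finset.sum_le_sum fun α hα => ?_)
  refine triple a hb hmax α (h3 α hα) fun x hx => ?_
  have := hdual α hα x (hD hx)
  simp only [Pi.add_apply, Finset.sum_apply, mul_add, Finset.sum_add_distrib, Pi.single_apply,
    Finset.mul_sum, mul_ite, mul_one, mul_zero] at this
  rw [Finset.sum_comm] at this
  simp only [Finset.sum_ite_eq', Finset.mem_univ, if_true] at this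
  exact CharTwo.add_eq_zero.mp this

/-- Growth of the zero set in one step. -/
lemma step_zero {n : ℕ} {D : Set (Fin n → ZMod 2)} {b : Fin n} (hb : b ∉ Z D) :
    (Z D).card + (cls D b).card ≤ (Z {x ∈ D | x b = 0}).card := by
  have hdis : Disjoint (Z D) (cls D b) := by
    rw [Finset.disjoint_left]
    intro c hc hc'
    apply hb
    rw [mem_Z]
    intro x hx
    rw [← mem_cls.mp hc' x hx]
    exact mem_Z.mp hc x hx
  rw [← Finset.card_union_of_disjoint hdis]
  apply Finset.card_le_card
  intro c hc
  rw [mem_Z]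
  rintro x ⟨hx, hxb⟩
  rcases Finset.mem_union.mp hc with hc | hc
  · exact mem_Z.mp hc x hx
  · rw [mem_cls.mp hc x hx, hxb]

lemma exists_pick {n : ℕ} (hn : 1 ≤ n) (D : Set (Fin n → ZMod 2)) :
    ∃ b : Fin n, (∃ i, i ∉ Z D) → b ∉ Z D ∧ ∀ i, i ∉ Z D → (cls D i).card ≤ (cls D b).card := by
  by_cases h : ∃ i, i ∉ Z D
  · obtain ⟨i, hi⟩ := h
    obtain ⟨b, hb, hm⟩ := Finset.exists_max_image (Finset.univ.filter fun i => i ∉ Z D)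
      (fun i => (cls D i).card) ⟨i, by simpa using hi⟩
    refine ⟨b, fun _ => ⟨by simpa using hb, fun i hi => hm i (by simpa using hi)⟩⟩
  · exact ⟨⟨0, hn⟩, fun h' => absurd h' h⟩

/-- The greedy sequence. -/
lemma exists_seq {n : ℕ} (hn : 1 ≤ n) (C : Submodule (ZMod 2) (Fin n → ZMod 2)) :
    ∃ (D : ℕ → Set (Fin n → ZMod 2)) (b : ℕ → Fin n),
      D 0 = C ∧ (∀ j, D (j + 1) = {x ∈ D j | x (b j) = 0}) ∧
      ∀ j < Module.finrank (ZMod 2) C, b j ∉ Z (D j) ∧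
        ∀ i, i ∉ Z (D j) → (cls (D j) i).card ≤ (cls (D j) (b j)).card := by
  choose pick hpick using exists_pick hn
  let D : ℕ → Set (Fin n → ZMod 2) := fun j =>
    Nat.rec (C : Set (Fin n → ZMod 2)) (fun _ E => {x ∈ E | x (pick E) = 0}) j
  have h0 : D 0 = C := rfl
  have hs : ∀ j, D (j + 1) = {x ∈ D j | x (pick (D j)) = 0} := fun j => rfl
  refine ⟨D, fun j => pick (D j), h0, hs, fun j hj => hpick (D j) ?_⟩
  by_contra hne
  push Not at hne
  have hmem : ∀ j, ∀ x ∈ C, (∀ i < j, x (pick (D i)) = 0) → x ∈ D j := by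
    intro j
    induction j with
    | zero => intro x hx _; exact hx
    | succ j ih =>
      intro x hx h
      rw [hs]
      exact ⟨ih x hx fun i hi => h i (by omega), h j (by omega)⟩
  let f : C →ₗ[ZMod 2] (Fin j → ZMod 2) :=
    LinearMap.pi fun i => (LinearMap.proj (pick (D i))).comp C.subtype
  have hf : Function.Injective f := by
    rw [injective_iff_map_eq_zero]
    intro x hx
    have : (x : Fin n → ZMod 2) ∈ D j := by
      refine hmem j x x.2 fun i hi => ?_
      exact congrFun hx ⟨i, hi⟩
    ext i
    exact mem_Z.mp (hne i) x this
  have := LinearMap.finrank_le_finrank_of_injective hf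
  simp at this
  omega

/-- Counting lemma: a predicate on steps where the accumulated quantity grows. -/
lemma count_bound (p : ℕ → Prop) [DecidablePred p] (t Ψ w : ℕ → ℕ) (m k : ℕ)
    (ht : ∀ j < k, t j + w j ≤ t (j + 1)) (hw : ∀ j < k, p j → m ≤ w j)
    (hΨ : ∀ j < k, Ψ j ≤ Ψ (j + 1)) (hΨp : ∀ j < k, p j → Ψ j + t j ≤ Ψ (j + 1)) :
    ∀ j ≤ k, m * Nat.count p j ≤ t j ∧
      m * (Nat.count p j * (Nat.count p j - 1)) ≤ 2 * Ψ j := by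
  intro j
  induction j with
  | zero => intro _; simp
  | succ j ih =>
    intro hj
    obtain ⟨h1, h2⟩ := ih (by omega)
    have a1 := ht j (by omega)
    have a2 := hw j (by omega)
    have a3 := hΨ j (by omega)
    have a4 := hΨp j (by omega)
    rw [Nat.count_succ]
    by_cases hp : p j
    · simp only [hp, if_true]
      have a2 := a2 hp
      have a4 := a4 hp
      constructor
      · rw [mul_add]; omega
      · generalize Nat.count p j = c at *
        have : m * ((c + 1) * (c + 1 - 1)) = m * (c * (c - 1)) + 2 * (m * c) := by
          cases c with
          | zero => simp
          | succ c => simp only [Nat.add_sub_cancel]; ring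
        rw [this]; omega
    · simp only [hp, if_false, add_zero]
      constructor <;> omega

/-- Bound on the number of steps at each level. -/
lemma level_bound {n : ℕ} (hn : 1 ≤ n) (C : Submodule (ZMod 2) (Fin n → ZMod 2))
    (hC : IsPerfect3LCC n C) :
    ∃ lev : ℕ → ℕ, ∀ a, 2 ^ a * (Nat.count (fun j => lev j = a) (Module.finrank (ZMod 2) C)) ^ 2
      ≤ 4 * (n * (a + 2)) ∧ (∀ j, lev j < n) := by
  obtain ⟨D, b, h0, hs, hmax⟩ := exists_seq hn C
  set k := Module.finrank (ZMod 2) C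
  have hDC : ∀ j, D j ⊆ C := by
    intro j
    induction j with
    | zero => exact h0.le
    | succ j ih => rw [hs]; exact fun x hx => ih hx.1
  refine ⟨fun j => Nat.log 2 (cls (D j) (b j)).card, fun a => ⟨?_, ?_⟩⟩
  swap
  · intro j
    refine Nat.log_lt_of_lt_pow (card_cls_pos _ _).ne' ?_
    refine lt_of_le_of_lt (Finset.card_le_univ _) ?_
    simpa using Nat.lt_two_pow_self
  have key := count_bound (fun j => Nat.log 2 (cls (D j) (b j)).card = a)
    (fun j => (Z (D j)).card) (fun j => ∑ i, g a (D j) i) (fun j => (cls (D j) (b j)).card)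
    (2 ^ a) k
    (fun j hj => by
      show _ ≤ (Z (D (j + 1))).card
      rw [hs]; exact step_zero (hmax j hj).1)
    (fun j hj h => by
      rw [← h]
      exact Nat.pow_log_le_self 2 (card_cls_pos _ _).ne')
    (fun j hj => by
      refine Finset.sum_le_sum fun i _ => g_mono a ?_ i
      rw [hs]; exact fun x hx => hx.1)
    (fun j hj h => by
      show _ ≤ ∑ i, g a (D (j + 1)) i
      rw [hs]
      refine step_gain hC a (hDC j) (hmax j hj).1 fun i hi => ?_
      rw [← h]
      exact Nat.log_mono_right ((hmax j hj).2 i hi)) k le_rfl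
  obtain ⟨k1, k2⟩ := key
  have hΨ : ∑ i, g a (D k) i ≤ n * (a + 2) := by
    refine (Finset.sum_le_sum fun i _ => g_le a (D k) i).trans ?_
    simp
  have hZ : (Z (D k)).card ≤ n := by simpa using Finset.card_le_univ (Z (D k))
  generalize Nat.count (fun j => Nat.log 2 (cls (D j) (b j)).card = a) k = c at *
  have hna : n ≤ n * (a + 2) := Nat.le_mul_of_pos_right _ (by omega)
  rcases c with _ | _ | c
  · simp
  · simp at k1 ⊢; omega
  · simp only [Nat.add_sub_cancel] at k2
    have : 2 ^ a * (c + 1 + 1) ^ 2 ≤ 2 * (2 ^ a * ((c + 1 + 1) * (c + 1))) := by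
      have : (c + 1 + 1) ^ 2 ≤ 2 * ((c + 1 + 1) * (c + 1)) := by nlinarith
      calc _ ≤ 2 ^ a * (2 * ((c + 1 + 1) * (c + 1))) := Nat.mul_le_mul_left _ this
        _ = _ := by ring
    omega

lemma growth (a : ℕ) : (a : ℝ) + 2 ≤ 4 * (32 / 25 : ℝ) ^ a := by
  induction a with
  | zero => norm_num
  | succ a ih =>
    have : (1 : ℝ) ≤ (32 / 25 : ℝ) ^ a := one_le_pow₀ (by norm_num)
    rw [pow_succ]; push_cast; linarith

lemma real_level {n a c : ℕ} (h : 2 ^ a * c ^ 2 ≤ 4 * (n * (a + 2))) :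
    (c : ℝ) ≤ 4 * Real.sqrt n * (4 / 5 : ℝ) ^ a := by
  have h' : (2 : ℝ) ^ a * (c : ℝ) ^ 2 ≤ 4 * (n * (a + 2)) := by exact_mod_cast h
  refine abs_le_of_sq_le_sq' ?_ (by positivity) |>.2
  have hp : (0 : ℝ) < 2 ^ a := by positivity
  refine le_of_mul_le_mul_left (h'.trans ?_) hp
  have e : (2 : ℝ) ^ a * (4 * Real.sqrt n * (4 / 5 : ℝ) ^ a) ^ 2
      = 4 * (n * (4 * (32 / 25 : ℝ) ^ a)) := by
    rw [mul_pow, mul_pow, Real.sq_sqrt (Nat.cast_nonneg n), ← pow_mul, mul_comm a 2, pow_mul]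
    have : (32 / 25 : ℝ) ^ a = 2 ^ a * ((4 / 5 : ℝ) ^ 2) ^ a := by
      rw [← mul_pow]; norm_num
    rw [this]; ring
  rw [e]
  have := growth a
  gcongr

end LCCProof

/-- The dimension of a perfect 3-locally correctable code is `O(√n)`. -/
theorem perfect_3LCC_dimension :
    ∃ c : ℝ, 0 < c ∧
      ∀ n : ℕ, 1 ≤ n → ∀ C : Submodule (ZMod 2) (Fin n → ZMod 2),
        IsPerfect3LCC n C →
        (Module.finrank (ZMod 2) C : ℝ) ≤ c * Real.sqrt n := by
  refine ⟨20, by norm_num, fun n hn C hC => ?_⟩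
  obtain ⟨lev, hlev⟩ := LCCProof.level_bound hn C hC
  set k := Module.finrank (ZMod 2) C
  have hsum : k = ∑ a ∈ Finset.range n, Nat.count (fun j => lev j = a) k := by
    have := Finset.card_eq_sum_card_fiberwise (s := Finset.range k) (t := Finset.range n)
      (f := lev) (fun j _ => by simpa using (hlev 0).2 j)
    simpa [Nat.count_eq_card_filter_range] using this
  have hg : ∑ a ∈ Finset.range n, (4 / 5 : ℝ) ^ a ≤ 5 := by
    have h1 := geom_sum_eq (x := (4 / 5 : ℝ)) (by norm_num) n
    rw [h1]
    have : (0 : ℝ) ≤ (4 / 5 : ℝ) ^ n := by positivity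
    rw [div_le_iff_of_neg (by norm_num)]
    linarith
  calc (k : ℝ) = ∑ a ∈ Finset.range n, (Nat.count (fun j => lev j = a) k : ℝ) := by
        exact_mod_cast hsum
    _ ≤ ∑ a ∈ Finset.range n, 4 * Real.sqrt n * (4 / 5 : ℝ) ^ a :=
        Finset.sum_le_sum fun a _ => LCCProof.real_level (hlev a).1
    _ = 4 * Real.sqrt n * ∑ a ∈ Finset.range n, (4 / 5 : ℝ) ^ a := by rw [Finset.mul_sum]
    _ ≤ 4 * Real.sqrt n * 5 := by gcongr
    _ = 20 * Real.sqrt n := by ring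
end

section
/- Let σ ≥ 1 be an integer and let C ⊆ F₂ⁿ be a regular linear code such that for every coordinate i ∈ {1,…,n} the dual code C^⊥ contains at least σ vectors of Hamming weight 3 whose support contains i. Then dim C ≤ (2/√σ)·n. -/
open Finset

lemma count_aux (q τ : ℕ) {α : Type*} [Fintype α] [DecidableEq α] (s : α)
    (e : Fin τ × Bool → α) (he : Function.Injective e) (hes : ∀ p, e p ≠ s) :
    (univ.filter (fun f : α → Fin q => ∀ i, ¬ (f (e (i, false)) < f s ∧ f (e (i, true)) < f s))).card
      * q ^ (2 * τ + 1) = q ^ (Fintype.card α) * ∑ j : Fin q, (q ^ 2 - (j : ℕ) ^ 2) ^ τ := by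
  classical
  let ι : Option (Fin τ × Bool) → α := fun o => o.elim s e
  have hι : Function.Injective ι := by
    rintro (_ | a) (_ | b) h
    · rfl
    · exact absurd h.symm (hes b)
    · exact absurd h (hes a)
    · exact congrArg some (he h)
  let R := {x : α // ¬ x ∈ Set.range ι}
  let E : Option (Fin τ × Bool) ⊕ R ≃ α :=
    ((Equiv.ofInjective ι hι).sumCongr (Equiv.refl _)).trans (Equiv.Set.sumCompl (Set.range ι))
  have hE : ∀ o, E (Sum.inl o) = ι o := by intro o; rfl
  have hcard : Fintype.card α = 2 * τ + 1 + Fintype.card R := by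
    rw [← Fintype.card_congr E]; simp; ring
  let X : Finset (Fin q × (Fin τ → Bool → Fin q)) :=
    univ.filter (fun p => ∀ i, ¬ (p.2 i false < p.1 ∧ p.2 i true < p.1))
  let Φ : (α → Fin q) ≃ (Fin q × (Fin τ → Bool → Fin q)) × (R → Fin q) :=
    (E.symm.arrowCongr (Equiv.refl _)).trans <|
      (Equiv.sumArrowEquivProdArrow _ _ _).trans <|
      Equiv.prodCongr ((Equiv.piOptionEquivProd).trans
        (Equiv.prodCongr (Equiv.refl _) (Equiv.curry _ _ _))) (Equiv.refl _)
  have h1 : (univ.filter (fun f : α → Fin q =>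
      ∀ i, ¬ (f (e (i, false)) < f s ∧ f (e (i, true)) < f s))).card
      = (X ×ˢ (univ : Finset (R → Fin q))).card := by
    apply Finset.card_equiv Φ
    intro f
    have a1 : (Φ f).1.1 = f s := by
      change f (E (Sum.inl none)) = _
      rw [hE]; rfl
    have a2 : ∀ i b, (Φ f).1.2 i b = f (e (i, b)) := by
      intro i b
      change f (E (Sum.inl (some (i, b)))) = _
      rw [hE]; rfl
    simp [X, a1, a2]
  have h2 : X.card = ∑ j : Fin q, (q ^ 2 - (j : ℕ) ^ 2) ^ τ := by
    rw [card_eq_sum_card_fiberwise (f := Prod.fst) (t := univ) (by simp)]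
    refine sum_congr rfl fun j _ => ?_
    have : X.filter (fun p => p.1 = j) = (Fintype.piFinset (fun _ : Fin τ =>
        univ.filter (fun g : Bool → Fin q => ¬ (g false < j ∧ g true < j)))).map
          ⟨fun g => (j, g), Prod.mk_right_injective j⟩ := by
      ext ⟨j', g⟩
      simp only [X, mem_filter, mem_univ, true_and, mem_map, Fintype.mem_piFinset,
        Function.Embedding.coeFn_mk, Prod.mk.injEq]
      constructor
      · rintro ⟨h, rfl⟩
        exact ⟨g, h, rfl, rfl⟩
      · rintro ⟨g', h, rfl, rfl⟩
        exact ⟨h, rfl⟩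
    rw [this, card_map, Fintype.card_piFinset_const]
    congr 1
    rw [filter_not, card_sdiff_of_subset (filter_subset _ _)]
    have : (univ.filter (fun g : Bool → Fin q => g false < j ∧ g true < j))
        = Fintype.piFinset (fun _ : Bool => univ.filter (· < j)) := by
      ext g; simp
    have hj : (univ.filter (fun x : Fin q => x < j)).card = (j : ℕ) := by
      have : univ.filter (fun x : Fin q => x < j) = Iio j := by ext x; simp
      rw [this, Fin.card_Iio]
    rw [this, Fintype.card_piFinset]
    simp [hj]
  rw [h1, card_product, h2, hcard]
  simp
  ring

lemma num_aux (q : ℕ) (hq : 2 ≤ q) :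
    ∑ j : Fin q, (1 - ((j : ℕ) : ℝ) ^ 2 / (q : ℝ) ^ 2) ^ (q ^ 2) ≤ 2 * (q : ℝ) / ((q : ℝ) + 1) := by
  have h23 : q = 2 ∨ q = 3 ∨ 4 ≤ q := by omega
  rcases h23 with rfl | rfl | h4
  · norm_num [Fin.sum_univ_succ]
  · norm_num [Fin.sum_univ_succ]
  · have hq0 : (0 : ℝ) < q := by positivity
    have he : Real.exp (-1) ≤ 3 / 8 := by
      have := Real.exp_one_gt_d9
      rw [Real.exp_neg, inv_le_comm₀ (by positivity) (by positivity)]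
      linarith
    have h1 : ∀ j : Fin q, (1 - ((j : ℕ) : ℝ) ^ 2 / (q : ℝ) ^ 2) ^ (q ^ 2) ≤ (3 / 8 : ℝ) ^ (j : ℕ) := by
      intro j
      have hj : ((j : ℕ) : ℝ) ≤ q := by exact_mod_cast j.2.le
      have h0 : 0 ≤ 1 - ((j : ℕ) : ℝ) ^ 2 / (q : ℝ) ^ 2 := by
        rw [sub_nonneg, div_le_one (by positivity)]
        gcongr
      calc _ ≤ (Real.exp (-(((j : ℕ) : ℝ) ^ 2 / (q : ℝ) ^ 2))) ^ (q ^ 2) := by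
            gcongr
            have := Real.add_one_le_exp (-(((j : ℕ) : ℝ) ^ 2 / (q : ℝ) ^ 2))
            linarith
        _ = Real.exp (-1) ^ ((j : ℕ) ^ 2) := by
            rw [← Real.exp_nat_mul, ← Real.exp_nat_mul]
            congr 1
            push_cast
            field_simp
        _ ≤ (3 / 8) ^ ((j : ℕ) ^ 2) := by gcongr
        _ ≤ (3 / 8) ^ (j : ℕ) := by
            apply pow_le_pow_of_le_one (by norm_num) (by norm_num)
            exact Nat.le_self_pow (by norm_num) _
    calc _ ≤ ∑ j : Fin q, (3 / 8 : ℝ) ^ (j : ℕ) := sum_le_sum fun j _ => h1 j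
      _ = ∑ j ∈ range q, (3 / 8 : ℝ) ^ j := Fin.sum_univ_eq_sum_range (fun j => (3 / 8 : ℝ) ^ j) q
      _ ≤ 8 / 5 := by
          rw [geom_sum_eq (by norm_num)]
          have : (0 : ℝ) ≤ (3 / 8) ^ q := by positivity
          rw [div_le_iff_of_neg (by norm_num)]
          linarith
      _ ≤ _ := by
          rw [div_le_div_iff₀ (by norm_num) (by positivity)]
          have : (4 : ℝ) ≤ q := by exact_mod_cast h4
          linarith

lemma count_bound (q τ : ℕ) (hq : 2 ≤ q) (hqτ : q ^ 2 ≤ τ) {α : Type*} [Fintype α] [DecidableEq α]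
    (s : α) (e : Fin τ × Bool → α) (he : Function.Injective e) (hes : ∀ p, e p ≠ s) :
    ((univ.filter (fun f : α → Fin q =>
      ∀ i, ¬ (f (e (i, false)) < f s ∧ f (e (i, true)) < f s))).card : ℝ)
      ≤ (q : ℝ) ^ (Fintype.card α) * (2 / (q + 1)) := by
  have h := count_aux q τ s e he hes
  have hq0 : (0 : ℝ) < q := by positivity
  set c := (univ.filter (fun f : α → Fin q =>
      ∀ i, ¬ (f (e (i, false)) < f s ∧ f (e (i, true)) < f s))).card
  have h' : (c : ℝ) * (q : ℝ) ^ (2 * τ + 1) = (q : ℝ) ^ (Fintype.card α) *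
      ((q : ℝ) ^ (2 * τ) * ∑ j : Fin q, (1 - ((j : ℕ) : ℝ) ^ 2 / (q : ℝ) ^ 2) ^ τ) := by
    have := congrArg (Nat.cast : ℕ → ℝ) h
    push_cast at this
    rw [this]
    congr 1
    rw [mul_sum]
    refine sum_congr rfl fun j _ => ?_
    rw [pow_mul, ← mul_pow, Nat.cast_sub (Nat.pow_le_pow_left j.2.le 2)]
    push_cast
    congr 1
    field_simp
  have h2 : ∑ j : Fin q, (1 - ((j : ℕ) : ℝ) ^ 2 / (q : ℝ) ^ 2) ^ τ ≤ 2 * (q : ℝ) / ((q : ℝ) + 1) := by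
    refine le_trans (sum_le_sum fun j _ => ?_) (num_aux q hq)
    have hj : ((j : ℕ) : ℝ) ≤ q := by exact_mod_cast j.2.le
    apply pow_le_pow_of_le_one _ _ hqτ
    · rw [sub_nonneg, div_le_one (by positivity)]
      gcongr
    · have : 0 ≤ ((j : ℕ) : ℝ) ^ 2 / (q : ℝ) ^ 2 := by positivity
      linarith
  have h3 : (c : ℝ) * (q : ℝ) ^ (2 * τ + 1) ≤
      ((q : ℝ) ^ (Fintype.card α) * (2 / (q + 1))) * (q : ℝ) ^ (2 * τ + 1) := by
    rw [h']
    calc _ ≤ (q : ℝ) ^ (Fintype.card α) * ((q : ℝ) ^ (2 * τ) * (2 * q / (q + 1))) := by gcongr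
      _ = _ := by ring
  exact le_of_mul_le_mul_right h3 (by positivity)

lemma rank_le_bad {K α V : Type*} [Field K] [AddCommGroup V] [Module K V] [Fintype α]
    (v : α → V) (q : ℕ) (f : α → Fin q) (B : Finset α)
    (hB : ∀ s, s ∉ B → v s = 0 ∨ ∃ a b, f a < f s ∧ f b < f s ∧ v a + v b = v s) :
    Module.finrank K (Submodule.span K (Set.range v)) ≤ B.card := by
  classical
  have key : ∀ k : ℕ, ∀ s, (f s : ℕ) = k → v s ∈ Submodule.span K ((B.image v : Finset V) : Set V) := by
    intro k
    induction k using Nat.strong_induction_on with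
    | _ k ih =>
      intro s hs
      by_cases h : s ∈ B
      · exact Submodule.subset_span (by simpa using ⟨s, h, rfl⟩)
      · rcases hB s h with h0 | ⟨a, b, ha, hb, hab⟩
        · rw [h0]; exact Submodule.zero_mem _
        · rw [← hab]
          exact Submodule.add_mem _ (ih _ (hs ▸ ha) a rfl) (ih _ (hs ▸ hb) b rfl)
  have hle : Submodule.span K (Set.range v) ≤ Submodule.span K ((B.image v : Finset V) : Set V) := by
    rw [Submodule.span_le]
    rintro _ ⟨s, rfl⟩
    exact key _ s rfl
  have : FiniteDimensional K (Submodule.span K ((B.image v : Finset V) : Set V)) :=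
    FiniteDimensional.span_finset K _
  exact (Submodule.finrank_mono hle).trans ((finrank_span_finset_le_card _).trans card_image_le)

lemma core {K α V : Type*} [Field K] [AddCommGroup V] [Module K V] [Fintype α]
    (v : α → V) (τ : ℕ)
    (h : ∀ s, v s ≠ 0 → ∃ e : Fin τ × Bool → α, Function.Injective e ∧ (∀ p, e p ≠ s) ∧
      ∀ i, v (e (i, false)) + v (e (i, true)) = v s) :
    (Module.finrank K (Submodule.span K (Set.range v)) : ℝ)
      ≤ 2 / Real.sqrt (τ + 1) * Fintype.card α := by
  classical
  set d := Module.finrank K (Submodule.span K (Set.range v)) with hd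
  by_cases hτ : τ < 4
  · have h1 : (d : ℝ) ≤ Fintype.card α := by exact_mod_cast finrank_range_le_card v
    have h2 : Real.sqrt (τ + 1) ≤ 2 := by
      rw [Real.sqrt_le_left (by norm_num)]
      have : (τ : ℝ) + 1 ≤ 4 := by exact_mod_cast hτ
      linarith
    have h3 : 1 ≤ 2 / Real.sqrt (τ + 1) := by
      rw [le_div_iff₀ (by positivity)]; linarith
    calc (d : ℝ) ≤ 1 * Fintype.card α := by linarith
      _ ≤ _ := by gcongr
  · obtain ⟨q, hq⟩ : ∃ q, q = Nat.sqrt τ := ⟨_, rfl⟩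
    have hq2 : 2 ≤ q := by rw [hq, Nat.le_sqrt]; omega
    have hqτ : q ^ 2 ≤ τ := by rw [hq]; exact Nat.sqrt_le' τ
    have hqτ' : τ + 1 ≤ (q + 1) ^ 2 := by rw [hq]; exact Nat.lt_succ_sqrt' τ
    choose! e he hes hev using h
    let B : (α → Fin q) → Finset α := fun f => univ.filter fun s =>
      v s ≠ 0 ∧ ∀ i, ¬ (f (e s (i, false)) < f s ∧ f (e s (i, true)) < f s)
    have h1 : ∀ f, d ≤ (B f).card := by
      intro f
      apply rank_le_bad v q f
      intro s hs
      by_contra hc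
      push Not at hc
      apply hs
      simp only [B, mem_filter, mem_univ, true_and]
      refine ⟨hc.1, fun i hi => hc.2 _ _ hi.1 hi.2 (hev s hc.1 i)⟩
    have h2 : (q : ℝ) ^ Fintype.card α * d ≤ ∑ f : α → Fin q, ((B f).card : ℝ) := by
      calc _ = ∑ f : α → Fin q, (d : ℝ) := by simp
        _ ≤ _ := sum_le_sum fun f _ => by exact_mod_cast h1 f
    have h3 : ∑ f : α → Fin q, ((B f).card : ℝ) ≤
        ∑ s : α, (q : ℝ) ^ (Fintype.card α) * (2 / (q + 1)) := by
      have : ∑ f : α → Fin q, ((B f).card : ℝ) = ∑ s : α, ((univ.filter fun f : α → Fin q =>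
          v s ≠ 0 ∧ ∀ i, ¬ (f (e s (i, false)) < f s ∧ f (e s (i, true)) < f s)).card : ℝ) := by
        simp only [B, card_filter]
        push_cast
        exact sum_comm
      rw [this]
      refine sum_le_sum fun s _ => ?_
      by_cases h0 : v s = 0
      · simp [h0]; positivity
      · refine le_trans ?_ (count_bound q τ hq2 hqτ s (e s) (he s h0) (hes s h0))
        simp [h0]
    have h4 : (q : ℝ) ^ Fintype.card α * d ≤
        (q : ℝ) ^ Fintype.card α * (2 / (q + 1) * Fintype.card α) := by
      refine (h2.trans h3).trans (le_of_eq ?_)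
      simp; ring
    have hq0 : (0 : ℝ) < q := by positivity
    refine (le_of_mul_le_mul_left h4 (by positivity)).trans ?_
    gcongr
    rw [Real.sqrt_le_left (by positivity)]
    exact_mod_cast hqτ'

lemma zmod2_add_self {m : ℕ} (a : Fin m → ZMod 2) : a + a = 0 := by
  funext r; exact CharTwo.add_self_eq_zero _

lemma dens_aux (m n t : ℕ) (C : Submodule (ZMod 2) (Fin n → ZMod 2))
    (G : Fin m → Fin n → ZMod 2)
    (hG : Submodule.span (ZMod 2) (Set.range G) = C)
    (col : Fin n → Fin m → ZMod 2) (hcol : col = fun k r => G r k)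
    (ht : ∀ i, (univ.filter (fun k => col k = col i)).card = t)
    (φ : (Fin m → ZMod 2) → ℕ) (hφ : Function.Injective φ)
    (i : Fin n) (hi : col i ≠ 0) (F : Finset (Fin n → ZMod 2))
    (hF : ∀ y ∈ F, y ∈ dualSet (C : Set (Fin n → ZMod 2)) ∧ hammingNorm y = 3 ∧ y i ≠ 0) :
    F.card ≤ t ^ 2 * ((univ.image col).filter (fun a => a + col i ∈ univ.image col ∧
      φ a < φ (a + col i))).card := by
  classical
  set R := (univ.image col).filter (fun a => a + col i ∈ univ.image col ∧ φ a < φ (a + col i))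
    with hR
  have ht' : ∀ a ∈ univ.image col, (univ.filter (fun k => col k = a)).card = t := by
    intro a ha
    obtain ⟨k, _, rfl⟩ := mem_image.1 ha
    exact ht k
  have key : ∀ y ∈ F, ∃ p : Fin n × Fin n, col p.1 + col p.2 = col i ∧ φ (col p.1) < φ (col p.2) ∧
      univ.filter (fun k => y k ≠ 0) = {i, p.1, p.2} := by
    intro y hy
    obtain ⟨hd, hw, hyi⟩ := hF y hy
    have hone : ∀ k, y k ≠ 0 → y k = 1 := fun k hk => by
      revert hk; generalize y k = z; revert z; decide
    have hsum : ∑ k ∈ univ.filter (fun k => y k ≠ 0), col k = 0 := by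
      funext r
      have h := hd (G r) (by rw [← hG]; exact Submodule.subset_span ⟨r, rfl⟩)
      rw [Finset.sum_apply, sum_filter]
      simp only [Pi.zero_apply]
      refine Eq.trans ?_ h
      refine sum_congr rfl fun k _ => ?_
      split_ifs with hk
      · rw [hone k hk, hcol]; simp
      · push Not at hk
        simp [hk]
    have hc3 : (univ.filter (fun k => y k ≠ 0)).card = 3 := hw
    have hmem : i ∈ univ.filter (fun k => y k ≠ 0) := by simpa using hyi
    have hc2 : ((univ.filter (fun k => y k ≠ 0)).erase i).card = 2 := by
      rw [card_erase_of_mem hmem, hc3]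
    obtain ⟨j, k, hjk, hjk'⟩ := card_eq_two.1 hc2
    have hset : univ.filter (fun k => y k ≠ 0) = {i, j, k} := by
      rw [← insert_erase hmem, hjk']
    have hni : i ∉ ({j, k} : Finset (Fin n)) := by rw [← hjk']; simp
    rw [hset, sum_insert hni, sum_pair hjk] at hsum
    have hs : col j + col k = col i := by
      have := zmod2_add_self (col i)
      calc col j + col k = (col i + col i) + (col j + col k) := by rw [this, zero_add]
        _ = col i + (col i + (col j + col k)) := by abel
        _ = col i := by rw [hsum, add_zero]
    rcases lt_trichotomy (φ (col j)) (φ (col k)) with h | h | h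
    · exact ⟨(j, k), hs, h, hset⟩
    · exfalso
      rw [hφ h, zmod2_add_self] at hs
      exact hi hs.symm
    · exact ⟨(k, j), by rw [add_comm]; exact hs, h, by rw [hset, pair_comm]⟩
  have hne : Nonempty (Fin n × Fin n) := ⟨(i, i)⟩
  choose! p hp1 hp2 hp3 using key
  have hinj : Set.InjOn p (F : Set (Fin n → ZMod 2)) := by
    intro y hy z hz hyz
    have h1 := hp3 y hy
    have h2 := hp3 z hz
    rw [hyz, ← h2] at h1
    funext k
    have h3 : y k ≠ 0 ↔ z k ≠ 0 := by simpa using Finset.ext_iff.1 h1 k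
    revert h3
    generalize y k = a
    generalize z k = b
    revert a b
    decide
  have hmaps : ∀ y ∈ F, p y ∈ R.biUnion (fun a =>
      univ.filter (fun k => col k = a) ×ˢ univ.filter (fun k => col k = a + col i)) := by
    intro y hy
    have h2 : col (p y).2 = col (p y).1 + col i := by
      rw [← hp1 y hy, ← add_assoc, zmod2_add_self, zero_add]
    simp only [mem_biUnion, mem_product, mem_filter, mem_univ, true_and]
    refine ⟨col (p y).1, ?_, rfl, h2⟩
    simp only [hR, mem_filter]
    refine ⟨mem_image_of_mem _ (mem_univ _), ?_, ?_⟩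
    · rw [← h2]; exact mem_image_of_mem _ (mem_univ _)
    · rw [← h2]; exact hp2 y hy
  calc F.card ≤ _ := card_le_card_of_injOn p hmaps hinj
    _ ≤ R.card * t ^ 2 := by
        apply card_biUnion_le_card_mul
        intro a ha
        simp only [hR, mem_filter] at ha
        rw [card_product, ht' _ ha.1, ht' _ ha.2.1, sq]
    _ = _ := mul_comm _ _

theorem regular_LTC_dimension
    (σ m n : ℕ) (hσ : 1 ≤ σ)
    (C : Submodule (ZMod 2) (Fin n → ZMod 2))
    (G : Fin m → Fin n → ZMod 2)
    (hG : Submodule.span (ZMod 2) (Set.range G) = C)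
    (hreg : ∀ i j : Fin n,
      (Finset.univ.filter (fun k : Fin n => (fun r => G r k) = (fun r => G r i))).card =
      (Finset.univ.filter (fun k : Fin n => (fun r => G r k) = (fun r => G r j))).card)
    (hdens : ∀ i : Fin n, ∃ F : Finset (Fin n → ZMod 2),
      σ ≤ F.card ∧
      ∀ y ∈ F, y ∈ dualSet (C : Set (Fin n → ZMod 2)) ∧ hammingNorm y = 3 ∧ y i ≠ 0) :
    (Module.finrank (ZMod 2) C : ℝ) ≤ 2 / Real.sqrt σ * n := by
  classical
  rcases Nat.eq_zero_or_pos n with rfl | hn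
  · have : Module.finrank (ZMod 2) C = 0 := by
      have := Submodule.finrank_le C
      simpa using this
    simp [this]
  obtain ⟨col, hcol⟩ : ∃ col : Fin n → Fin m → ZMod 2, col = fun k r => G r k := ⟨_, rfl⟩
  obtain ⟨t, ht⟩ : ∃ t, ∀ i, (univ.filter (fun k => col k = col i)).card = t :=
    ⟨_, fun i => by rw [hcol]; exact hreg i ⟨0, hn⟩⟩
  have htpos : 0 < t := by
    rw [← ht ⟨0, hn⟩]
    exact card_pos.2 ⟨⟨0, hn⟩, by simp⟩
  let S := univ.image col
  have hnt : n = S.card * t := by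
    have := card_eq_sum_card_image col (univ : Finset (Fin n))
    rw [card_univ, Fintype.card_fin] at this
    rw [this, ← smul_eq_mul, ← sum_const]
    refine sum_congr rfl fun a ha => ?_
    obtain ⟨k, _, rfl⟩ := mem_image.1 ha
    exact ht k
  have hrank : Module.finrank (ZMod 2) C =
      Module.finrank (ZMod 2) (Submodule.span (ZMod 2) (Set.range (fun x : S => (x : Fin m → ZMod 2)))) := by
    have h1 : Set.range (fun x : S => (x : Fin m → ZMod 2)) = Set.range col := by
      ext a; simp [S]
    have h2 := Matrix.rank_eq_finrank_span_row (R := ZMod 2) (Matrix.of G)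
    have h3 := Matrix.rank_eq_finrank_span_cols (R := ZMod 2) (Matrix.of G)
    rw [h1, hcol, ← hG]
    exact h2.symm.trans h3
  obtain ⟨φ, hφ⟩ : ∃ φ : (Fin m → ZMod 2) → ℕ, Function.Injective φ :=
    ⟨fun a => (Fintype.equivFin _ a : ℕ), fun a b h => (Fintype.equivFin _).injective (Fin.ext h)⟩
  obtain ⟨τ, hτ⟩ : ∃ τ, τ = (σ - 1) / t ^ 2 := ⟨_, rfl⟩
  have ht2 : 0 < t ^ 2 := by positivity
  have hτσ : σ ≤ t ^ 2 * (τ + 1) := by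
    have := Nat.lt_mul_div_succ (σ - 1) ht2
    rw [← hτ] at this
    omega
  have hcore := core (K := ZMod 2) (fun x : S => (x : Fin m → ZMod 2)) τ (by
    rintro ⟨s, hs⟩ hs0
    simp only at hs0
    obtain ⟨i, _, rfl⟩ := mem_image.1 hs
    obtain ⟨F, hFσ, hF⟩ := hdens i
    have hd := dens_aux m n t C G hG col hcol ht φ hφ i hs0 F hF
    set R := (univ.image col).filter (fun a => a + col i ∈ univ.image col ∧ φ a < φ (a + col i))
      with hR
    have hRτ : τ + 1 ≤ R.card := by
      have : τ < R.card := by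
        rw [hτ, Nat.div_lt_iff_lt_mul ht2, mul_comm]
        omega
      omega
    let R₀ := R.filter (fun a => a ≠ 0 ∧ a ≠ col i)
    have hR₀ : τ ≤ R₀.card := by
      by_cases hh : φ 0 < φ (col i)
      · have : R.erase 0 ⊆ R₀ := by
          intro a ha
          rw [mem_erase] at ha
          refine mem_filter.2 ⟨ha.2, ha.1, ?_⟩
          rintro rfl
          have := (mem_filter.1 ha.2).2.2
          rw [zmod2_add_self] at this
          omega
        have h1 := card_le_card this
        have h2 := pred_card_le_card_erase (s := R) (a := 0)
        omega
      · have : R.erase (col i) ⊆ R₀ := by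
          intro a ha
          rw [mem_erase] at ha
          refine mem_filter.2 ⟨ha.2, ?_, ha.1⟩
          rintro rfl
          have := (mem_filter.1 ha.2).2.2
          rw [zero_add] at this
          omega
        have h1 := card_le_card this
        have h2 := pred_card_le_card_erase (s := R) (a := col i)
        omega
    obtain ⟨ι⟩ : Nonempty (Fin τ ↪ R₀) := by
      apply Function.Embedding.nonempty_of_card_le
      simpa using hR₀
    have hιR : ∀ x, (ι x : Fin m → ZMod 2) ∈ R := fun x => (mem_filter.1 (ι x).2).1
    have hι0 : ∀ x, (ι x : Fin m → ZMod 2) ≠ 0 := fun x => (mem_filter.1 (ι x).2).2.1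
    have hιs : ∀ x, (ι x : Fin m → ZMod 2) ≠ col i := fun x => (mem_filter.1 (ι x).2).2.2
    have hιS : ∀ x, (ι x : Fin m → ZMod 2) ∈ S := fun x => (mem_filter.1 (hιR x)).1
    have hιS' : ∀ x, (ι x : Fin m → ZMod 2) + col i ∈ S := fun x => (mem_filter.1 (hιR x)).2.1
    have hιφ : ∀ x, φ (ι x : Fin m → ZMod 2) < φ ((ι x : Fin m → ZMod 2) + col i) :=
      fun x => (mem_filter.1 (hιR x)).2.2
    have hbad : ∀ x y, (ι x : Fin m → ZMod 2) ≠ (ι y : Fin m → ZMod 2) + col i := by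
      intro x y h
      have h1 := hιφ x
      have h2 := hιφ y
      rw [h, add_assoc, zmod2_add_self, add_zero] at h1
      omega
    refine ⟨fun p => if p.2 then ⟨_, hιS' p.1⟩ else ⟨_, hιS p.1⟩, ?_, ?_, ?_⟩
    · rintro ⟨x, _ | _⟩ ⟨y, _ | _⟩ h
      · have := congrArg Subtype.val h
        simp only [Bool.false_eq_true, if_false] at this
        rw [ι.injective (Subtype.ext this)]
      · have := congrArg Subtype.val h
        simp only [Bool.false_eq_true, if_false, if_true] at this
        exact absurd this (hbad x y)
      · have := congrArg Subtype.val h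
        simp only [Bool.false_eq_true, if_false, if_true] at this
        exact absurd this.symm (hbad y x)
      · have := congrArg Subtype.val h
        simp only [if_true] at this
        rw [ι.injective (Subtype.ext (add_right_cancel this))]
    · rintro ⟨x, _ | _⟩ h
      · have := congrArg Subtype.val h
        simp only [Bool.false_eq_true, if_false] at this
        exact hιs x this
      · have := congrArg Subtype.val h
        simp only [if_true] at this
        exact hι0 x (by simpa using this)
    · intro x
      simp only [Bool.false_eq_true, if_false, if_true]
      rw [← add_assoc, zmod2_add_self, zero_add])
  rw [hrank]
  refine hcore.trans ?_
  rw [Fintype.card_coe]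
  have hσ0 : (0 : ℝ) < Real.sqrt σ := Real.sqrt_pos.2 (by exact_mod_cast hσ)
  have hsq : Real.sqrt σ ≤ t * Real.sqrt (τ + 1) := by
    have : (σ : ℝ) ≤ (t : ℝ) ^ 2 * ((τ : ℝ) + 1) := by exact_mod_cast hτσ
    calc Real.sqrt σ ≤ Real.sqrt ((t : ℝ) ^ 2 * ((τ : ℝ) + 1)) := Real.sqrt_le_sqrt this
      _ = _ := by rw [Real.sqrt_mul (by positivity), Real.sqrt_sq (by positivity)]
  have hnt' : (n : ℝ) = S.card * t := by exact_mod_cast hnt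
  rw [hnt', div_mul_eq_mul_div, div_mul_eq_mul_div, div_le_div_iff₀ (by positivity) hσ0]
  calc 2 * (S.card : ℝ) * Real.sqrt σ ≤ 2 * (S.card : ℝ) * (t * Real.sqrt (τ + 1)) := by gcongr
    _ = _ := by ring
end

section
/- Let G be a matrix over F₂ whose rows span a code C ⊆ F₂ⁿ, with columns v₁,…,vₙ, and let p = maxᵢ #{j : vⱼ = vᵢ} be the maximal multiplicity of a column of G. Let σ > p be an integer and suppose that for every coordinate i ∈ {1,…,n} the dual code C^⊥ contains at least σ vectors of Hamming weight 3 whose support contains i. Then, writing K = ⌈σ/p⌉, dim C ≤ (n·log₂(K+1) + n/ln 2)/(K+1). -/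
open Finset in
theorem aux_lip {V : Type*} [AddCommGroup V] [Fintype V] [DecidableEq V]
    (hV : ∀ x : V, x + x = 0) (b f : V → ℕ) (v : V)
    (hf : ∀ u, f (u + v) ≤ f u + 1) (u : V) :
    ∑ w, b w * f (u + v + w) + ∑ w, min (b w) (b (w + v)) ≤
      ∑ w, b w * f (u + w) + ∑ w, b w := by
  have hsym : ∑ w, min (b w) (b (w + v)) * f (u + v + w) =
      ∑ w, min (b w) (b (w + v)) * f (u + w) := by
    refine Fintype.sum_equiv (Equiv.addRight v) _ _ ?_
    intro w
    have h1 : w + v + v = w := by rw [add_assoc, hV, add_zero]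
    simp only [Equiv.coe_addRight, h1]
    rw [min_comm]
    congr 2
    abel
  have key : ∑ w, (b w * f (u + v + w) + min (b w) (b (w + v))
        + min (b w) (b (w + v)) * f (u + w)) ≤
      ∑ w, (b w * f (u + w) + b w + min (b w) (b (w + v)) * f (u + v + w)) := by
    refine sum_le_sum fun w _ => ?_
    obtain ⟨d, hd⟩ := Nat.exists_eq_add_of_le (min_le_left (b w) (b (w + v)))
    generalize min (b w) (b (w + v)) = μ at *
    have h := hf (u + w)
    have e : u + w + v = u + v + w := by abel
    rw [e] at h
    rw [hd]
    nlinarith [Nat.mul_le_mul_left d h]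
  simp only [sum_add_distrib] at key
  omega

open Finset in
theorem aux_even {V : Type*} [AddCommGroup V] [Fintype V] [DecidableEq V]
    (hV : ∀ x : V, x + x = 0) (v : V) (hv : v ≠ 0) (c : V → ℕ) :
    Even (∑ w, min (c w) (c (w + v))) := by
  rw [← ZMod.natCast_eq_zero_iff_even]
  push_cast
  have h1 : ∀ w : V, w + v + v = w := fun w => by rw [add_assoc, hV, add_zero]
  refine Finset.sum_involution (fun w _ => w + v) ?_ ?_ ?_ ?_
  · intro w _
    rw [h1, min_comm (c (w + v))]
    exact CharTwo.add_self_eq_zero _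
  · intro w _ _
    simpa using hv
  · intro w _
    simp
  · intro w _
    exact h1 w

open Finset in
theorem aux_pairs {V : Type*} [AddCommGroup V] [Fintype V] [DecidableEq V] {n : ℕ}
    (hV : ∀ x : V, x + x = 0) (a : Fin n → V) (i : Fin n) :
    ((univ : Finset (Fin n × Fin n)).filter
      (fun q => q.1 ≠ i ∧ q.2 ≠ i ∧ a q.1 + a q.2 = a i)).card =
    ∑ w, (univ.filter (fun j => j ≠ i ∧ a j = w)).card *
      (univ.filter (fun j => j ≠ i ∧ a j = w + a i)).card := by
  rw [card_eq_sum_card_fiberwise (f := fun q => a q.1) (t := univ) (by simp)]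
  refine sum_congr rfl fun w _ => ?_
  rw [← card_product]
  congr 1
  ext ⟨j, l⟩
  simp only [mem_filter, mem_univ, true_and, mem_product]
  constructor
  · rintro ⟨⟨h1, h2, h3⟩, h4⟩
    refine ⟨⟨h1, h4⟩, h2, ?_⟩
    rw [← h3, h4, ← add_assoc, hV, zero_add]
  · rintro ⟨⟨h1, h4⟩, h2, h3⟩
    refine ⟨⟨h1, h2, ?_⟩, h4⟩
    rw [h3, h4, ← add_assoc, hV, zero_add]

/-- multiplicity with an extra zero -/
def bmul {V : Type*} [AddCommGroup V] [DecidableEq V] {n : ℕ} (a : Fin n → V) (w : V) : ℕ :=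
  (Finset.univ.filter (fun j => a j = w)).card + if w = 0 then 1 else 0

open Finset in
theorem aux_min {V : Type*} [AddCommGroup V] [Fintype V] [DecidableEq V] {n : ℕ}
    (hV : ∀ x : V, x + x = 0) (a : Fin n → V) (i : Fin n) (hi : a i ≠ 0) :
    ∑ w, min (bmul a w) (bmul a (w + a i)) =
    ∑ w, min (univ.filter (fun j => j ≠ i ∧ a j = w)).card
      (univ.filter (fun j => j ≠ i ∧ a j = w + a i)).card + 2 := by
  have hc : ∀ w, bmul a w = (univ.filter (fun j => j ≠ i ∧ a j = w)).card +
      (if w = 0 then 1 else 0) + (if w = a i then 1 else 0) := by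
    intro w
    unfold bmul
    have : (univ.filter (fun j => j ≠ i ∧ a j = w)) = (univ.filter (fun j => a j = w)).erase i := by
      ext j; simp
    rw [this]
    by_cases h : w = a i
    · have hm : i ∈ univ.filter (fun j => a j = w) := by simp [h]
      have := card_erase_add_one hm
      simp only [h, if_true] at *
      omega
    · rw [erase_eq_of_notMem (by simpa using fun h' => h h'.symm)]
      simp [h]
  have h1 : ∀ w : V, w + a i = 0 ↔ w = a i := by
    intro w
    constructor
    · intro h
      rw [eq_neg_of_add_eq_zero_left h, ← eq_neg_of_add_eq_zero_left (hV (a i))]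
    · rintro rfl; exact hV _
  have h2 : ∀ w : V, w + a i = a i ↔ w = 0 := by intro w; simp
  have h3 : ∀ w, min (bmul a w) (bmul a (w + a i)) =
      min (univ.filter (fun j => j ≠ i ∧ a j = w)).card
      (univ.filter (fun j => j ≠ i ∧ a j = w + a i)).card +
      ((if w = 0 then 1 else 0) + (if w = a i then 1 else 0)) := by
    intro w
    rw [hc, hc]
    simp only [h1, h2]
    omega
  simp only [h3, sum_add_distrib]
  simp

open Finset in
theorem aux_bsum {V : Type*} [AddCommGroup V] [Fintype V] [DecidableEq V] {n : ℕ}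
    (a : Fin n → V) (g : V → ℕ) :
    ∑ w, bmul a w * g w = ∑ j, g (a j) + g 0 := by
  unfold bmul
  simp only [add_mul, sum_add_distrib]
  congr 1
  · rw [← sum_fiberwise (univ : Finset (Fin n)) a]
    refine sum_congr rfl fun w _ => ?_
    rw [sum_congr rfl (g := fun _ => g w)]
    · simp
    · intro j hj
      simp at hj
      rw [hj]
  · simp

/-- word length -/
noncomputable def wlen {V : Type*} [AddCommGroup V] {n : ℕ} (a : Fin n → V) (u : V) : ℕ :=
  sInf {r | ∃ T : Finset (Fin n), ∑ j ∈ T, a j = u ∧ T.card = r}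

theorem wlen_le {V : Type*} [AddCommGroup V] {n : ℕ} (a : Fin n → V) (T : Finset (Fin n)) :
    wlen a (∑ j ∈ T, a j) ≤ T.card := Nat.sInf_le ⟨T, rfl, rfl⟩

open Finset in
theorem aux_flip {V : Type*} [AddCommGroup V] {n : ℕ}
    (hV : ∀ x : V, x + x = 0) (a : Fin n → V) (i : Fin n) (T : Finset (Fin n)) :
    ∃ T' : Finset (Fin n), ∑ j ∈ T', a j = ∑ j ∈ T, a j + a i ∧ T'.card ≤ T.card + 1 := by
  by_cases h : i ∈ T
  · refine ⟨T.erase i, ?_, ?_⟩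
    · rw [← sum_erase_add T a h, add_assoc, hV, add_zero]
    · have := card_erase_le (s := T) (a := i); omega
  · refine ⟨insert i T, ?_, ?_⟩
    · rw [sum_insert h, add_comm]
    · rw [card_insert_of_notMem h]

theorem wlen_add {V : Type*} [AddCommGroup V] {n : ℕ}
    (hV : ∀ x : V, x + x = 0) (a : Fin n → V) (i : Fin n) (u : V) :
    wlen a (u + a i) ≤ wlen a u + 1 := by
  by_cases h : ∃ T : Finset (Fin n), ∑ j ∈ T, a j = u
  · have hne : {r | ∃ T : Finset (Fin n), ∑ j ∈ T, a j = u ∧ T.card = r}.Nonempty := by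
      obtain ⟨T, hT⟩ := h; exact ⟨_, T, hT, rfl⟩
    obtain ⟨T, hT, hc⟩ := Nat.sInf_mem hne
    obtain ⟨T', h1, h2⟩ := aux_flip hV a i T
    have := wlen_le a T'
    rw [h1, hT] at this
    unfold wlen at *
    omega
  · have : {r | ∃ T : Finset (Fin n), ∑ j ∈ T, a j = u + a i ∧ T.card = r} = ∅ := by
      ext r
      simp only [Set.mem_setOf_eq, Set.mem_empty_iff_false, iff_false]
      rintro ⟨T, hT, -⟩
      obtain ⟨T', h1, -⟩ := aux_flip hV a i T
      exact h ⟨T', by rw [h1, hT, add_assoc, hV, add_zero]⟩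
    unfold wlen
    rw [this]
    simp

open Finset in
/-- Bonnet-Myers type bound. -/
theorem aux_radius {V : Type*} [AddCommGroup V] [Fintype V] [DecidableEq V] {n : ℕ}
    (hV : ∀ x : V, x + x = 0) (a : Fin n → V) (K : ℕ)
    (hK : ∀ i, a i ≠ 0 → 2 * K + 2 ≤ ∑ w, min (bmul a w) (bmul a (w + a i)))
    (T₀ : Finset (Fin n)) :
    ∃ T : Finset (Fin n), ∑ j ∈ T, a j = ∑ j ∈ T₀, a j ∧ T.card * (K + 1) ≤ n := by
  have hne : {r | ∃ T : Finset (Fin n), ∑ j ∈ T, a j = ∑ j ∈ T₀, a j ∧ T.card = r}.Nonempty :=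
    ⟨_, T₀, rfl, rfl⟩
  obtain ⟨T, hT, hc⟩ := Nat.sInf_mem hne
  refine ⟨T, hT, ?_⟩
  have hw : wlen a (∑ j ∈ T, a j) = T.card := by rw [hT, hc]; rfl
  have hnz : ∀ i ∈ T, a i ≠ 0 := by
    intro i hi h0
    have h1 := wlen_le a (T.erase i)
    have h2 := sum_erase_add T a hi
    rw [h0, add_zero] at h2
    rw [h2, hw] at h1
    have := card_erase_lt_of_mem hi
    omega
  have hB : ∑ w, bmul a w = n + 1 := by
    have := aux_bsum a (fun _ => 1)
    simpa using this
  have hind : ∀ S : Finset (Fin n), (∀ i ∈ S, a i ≠ 0) →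
      ∑ w, bmul a w * wlen a (∑ j ∈ S, a j + w) + S.card * (2 * K + 2) ≤
      ∑ w, bmul a w * wlen a (0 + w) + S.card * (n + 1) := by
    intro S
    induction S using Finset.induction_on with
    | empty => simp
    | insert i S hi ih =>
      intro h
      have ih' := ih (fun j hj => h j (mem_insert_of_mem hj))
      have h1 := aux_lip hV (bmul a) (wlen a) (a i) (wlen_add hV a i) (∑ j ∈ S, a j)
      have h2 := hK i (h i (mem_insert_self _ _))
      rw [hB] at h1
      rw [sum_insert hi, card_insert_of_notMem hi, add_comm (a i)]
      nlinarith
  have h := hind T hnz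
  rw [aux_bsum a (fun w => wlen a (∑ j ∈ T, a j + w)), aux_bsum a (fun w => wlen a (0 + w))] at h
  simp only [add_zero, zero_add, hw] at h
  have h0 : wlen a 0 = 0 := by
    have := wlen_le a ∅
    simpa using this
  have h1 : ∑ j, wlen a (a j) ≤ n := by
    calc ∑ j, wlen a (a j) ≤ ∑ j : Fin n, 1 := by
          refine sum_le_sum fun j _ => ?_
          have := wlen_le a {j}
          simpa using this
      _ = n := by simp
  have h2 : n * T.card ≤ ∑ j, wlen a (∑ j ∈ T, a j + a j) + n := by
    calc n * T.card = ∑ j : Fin n, T.card := by simp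
      _ ≤ ∑ j, (wlen a (∑ j ∈ T, a j + a j) + 1) := by
          refine sum_le_sum fun j _ => ?_
          have := wlen_add hV a j (∑ j ∈ T, a j + a j)
          rwa [add_assoc, hV, add_zero, hw] at this
      _ = _ := by simp [sum_add_distrib]
  nlinarith

open Finset in
theorem aux_final (k n K : ℕ)
    (h : 2 ^ k ≤ ((univ : Finset (Finset (Fin n))).filter (fun T => T.card * (K + 1) ≤ n)).card) :
    (k : ℝ) ≤ ((n : ℝ) * Real.logb 2 ((K : ℝ) + 1) + (n : ℝ) / Real.log 2) / ((K : ℝ) + 1) := by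
  set D : ℝ := (K : ℝ) + 1 with hD
  have hD1 : 1 ≤ D := by simp [hD]
  have hD0 : 0 < D := by linarith
  set B := (univ : Finset (Finset (Fin n))).filter (fun T => T.card * (K + 1) ≤ n)
  have hsum : ∑ T : Finset (Fin n), (D⁻¹) ^ T.card = (D⁻¹ + 1) ^ n := by
    have := Fintype.sum_pow_mul_eq_add_pow (Fin n) (D⁻¹) (1 : ℝ)
    simpa using this
  have hlog2 : 0 < Real.log 2 := Real.log_pos (by norm_num)
  have hlogD : 0 ≤ Real.log D := Real.log_nonneg hD1
  have hB : ((B.card : ℝ)) * Real.exp (-(n / D * Real.log D)) ≤ (D⁻¹ + 1) ^ n := by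
    rw [← hsum, ← nsmul_eq_mul]
    calc B.card • Real.exp (-(n / D * Real.log D)) ≤ ∑ T ∈ B, (D⁻¹) ^ T.card := by
          refine card_nsmul_le_sum _ _ _ fun T hT => ?_
          have hT' : (T.card : ℝ) * D ≤ n := by
            have := (mem_filter.1 hT).2
            rw [hD]; exact_mod_cast this
          have : (D⁻¹) ^ T.card = Real.exp (-(T.card * Real.log D)) := by
            rw [Real.exp_neg, Real.exp_nat_mul, Real.exp_log hD0, inv_pow]
          rw [this]
          apply Real.exp_le_exp.2
          have : (T.card : ℝ) ≤ n / D := by rwa [le_div_iff₀ hD0]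
          nlinarith [mul_le_mul_of_nonneg_right this hlogD]
      _ ≤ _ := sum_le_sum_of_subset_of_nonneg (subset_univ _) (fun _ _ _ => by positivity)
  have hup : (D⁻¹ + 1) ^ n ≤ Real.exp (n * D⁻¹) := by
    rw [Real.exp_nat_mul]
    exact pow_le_pow_left₀ (by positivity) (Real.add_one_le_exp _) n
  have h2 : (2 : ℝ) ^ k ≤ B.card := by exact_mod_cast h
  have h3 : Real.exp (k * Real.log 2 + -(n / D * Real.log D)) ≤ Real.exp (n * D⁻¹) := by
    rw [Real.exp_add, Real.exp_nat_mul, Real.exp_log (by norm_num)]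
    exact le_trans (mul_le_mul_of_nonneg_right h2 (Real.exp_pos _).le) (hB.trans hup)
  have h4 := Real.exp_le_exp.1 h3
  have h5 : (n * Real.logb 2 D + n / Real.log 2) / D
      = (n / D * Real.log D + n * D⁻¹) / Real.log 2 := by
    unfold Real.logb
    field_simp
  rw [h5, le_div_iff₀ hlog2]
  linarith

open Finset in
theorem aux_count {m n : ℕ} (σ : ℕ) (a : Fin n → (Fin m → ZMod 2)) (i : Fin n) (hi : a i ≠ 0)
    (F : Finset (Fin n → ZMod 2)) (hF : σ ≤ F.card)
    (h : ∀ y ∈ F, ∑ j, y j • a j = 0 ∧ hammingNorm y = 3 ∧ y i ≠ 0) :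
    2 * σ ≤ ((univ : Finset (Fin n × Fin n)).filter
      (fun q => q.1 ≠ i ∧ q.2 ≠ i ∧ a q.1 + a q.2 = a i)).card := by
  set P := (univ : Finset (Fin n × Fin n)).filter
      (fun q => q.1 ≠ i ∧ q.2 ≠ i ∧ a q.1 + a q.2 = a i) with hP
  let g : Fin n × Fin n → (Fin n → ZMod 2) := fun q r => if r = i ∨ r = q.1 ∨ r = q.2 then 1 else 0
  have hone : ∀ z : ZMod 2, z ≠ 0 → z = 1 := by decide
  have hfib : ∀ y ∈ F, 2 ≤ (P.filter (fun q => g q = y)).card := by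
    intro y hy
    obtain ⟨h1, h2, h3⟩ := h y hy
    have hs : (univ.filter (fun j => y j ≠ 0)).card = 3 := by
      rw [← h2]; simp [hammingNorm]
    have him : i ∈ univ.filter (fun j => y j ≠ 0) := by simpa using h3
    have he : ((univ.filter (fun j => y j ≠ 0)).erase i).card = 2 := by
      rw [card_erase_of_mem him, hs]
    obtain ⟨j, l, hjl, he'⟩ := card_eq_two.1 he
    have hj : j ∈ (univ.filter (fun j => y j ≠ 0)).erase i := by rw [he']; simp
    have hl : l ∈ (univ.filter (fun j => y j ≠ 0)).erase i := by rw [he']; simp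
    have hsup : univ.filter (fun j => y j ≠ 0) = insert i {j, l} := by
      rw [← he', insert_erase him]
    have hji : j ≠ i := (mem_erase.1 hj).1
    have hli : l ≠ i := (mem_erase.1 hl).1
    have hsum : a i + (a j + a l) = 0 := by
      rw [← h1]
      have : ∑ r, y r • a r = ∑ r ∈ univ.filter (fun j => y j ≠ 0), a r := by
        rw [sum_filter]
        refine sum_congr rfl fun r _ => ?_
        by_cases hr : y r = 0
        · simp [hr]
        · simp [hone _ hr]
      rw [this, hsup, sum_insert (by simp [hji.symm, hli.symm]), sum_pair hjl]
    have hadd : a j + a l = a i := by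
      have h4 : a i + a i = 0 := by ext r; exact CharTwo.add_self_eq_zero _
      exact add_left_cancel (hsum.trans h4.symm)
    have hy' : ∀ r, y r = if r = i ∨ r = j ∨ r = l then 1 else 0 := by
      intro r
      have : r ∈ univ.filter (fun j => y j ≠ 0) ↔ r ∈ insert i ({j, l} : Finset (Fin n)) := by
        rw [hsup]
      simp only [mem_filter, mem_univ, true_and, mem_insert, mem_singleton] at this
      by_cases hr : y r = 0
      · rw [hr, if_neg]; tauto
      · rw [hone _ hr, if_pos]; tauto
    refine (card_pair (a := (j, l)) (b := (l, j)) (by simp [hjl])).symm.le.trans ?_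
    apply card_le_card
    intro q hq
    simp only [mem_insert, mem_singleton] at hq
    rcases hq with rfl | rfl
    · simp only [hP, mem_filter, mem_univ, true_and]
      exact ⟨⟨hji, hli, hadd⟩, by funext r; rw [hy' r]⟩
    · simp only [hP, mem_filter, mem_univ, true_and]
      refine ⟨⟨hli, hji, by rw [add_comm]; exact hadd⟩, ?_⟩
      funext r
      rw [hy' r]
      simp only [g]
      congr 1
      simp only [eq_iff_iff]
      tauto
  calc 2 * σ ≤ F.card • 2 := by simp; omega
    _ ≤ ∑ y ∈ F, (P.filter (fun q => g q = y)).card := card_nsmul_le_sum _ _ _ hfib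
    _ ≤ ∑ y, (P.filter (fun q => g q = y)).card :=
        sum_le_sum_of_subset (subset_univ _)
    _ = P.card := (card_eq_sum_card_fiberwise (by simp)).symm


/-- If each coordinate lies in the support of at least `σ` weight-3 vectors of `C^⊥`,
and `p` is the maximal column multiplicity of a generating matrix of `C`, with
`σ > p`, then for `K = ⌈σ/p⌉` we have `dim C ≤ (n log₂(K+1) + n/ln 2)/(K+1)`. -/
theorem LTC_bounded_repetitions
    (σ p K m n : ℕ)
    (C : Submodule (ZMod 2) (Fin n → ZMod 2))
    (G : Fin m → Fin n → ZMod 2)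
    (hG : Submodule.span (ZMod 2) (Set.range G) = C)
    (hp : p = Finset.univ.sup (fun i : Fin n =>
      (Finset.univ.filter (fun j : Fin n => (fun r => G r j) = (fun r => G r i))).card))
    (hσp : p < σ)
    (hK : K = (σ + p - 1) / p)
    (hdens : ∀ i : Fin n, ∃ F : Finset (Fin n → ZMod 2),
      σ ≤ F.card ∧
      ∀ y ∈ F, y ∈ dualSet (C : Set (Fin n → ZMod 2)) ∧ hammingNorm y = 3 ∧ y i ≠ 0) :
    (Module.finrank (ZMod 2) C : ℝ) ≤
      ((n : ℝ) * Real.logb 2 ((K : ℝ) + 1) + (n : ℝ) / Real.log 2) / ((K : ℝ) + 1) := by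
  classical
  have hV : ∀ x : Fin m → ZMod 2, x + x = 0 := fun x => by
    ext r; exact CharTwo.add_self_eq_zero _
  have hone : ∀ z : ZMod 2, z ≠ 0 → z = 1 := by decide
  let a : Fin n → (Fin m → ZMod 2) := fun j r => G r j
  have hple : ∀ w, (Finset.univ.filter (fun j => a j = w)).card ≤ p := by
    intro w
    by_cases h : ∃ i, a i = w
    · obtain ⟨i, rfl⟩ := h
      rw [hp]
      exact Finset.le_sup (f := fun i : Fin n =>
        (Finset.univ.filter (fun j : Fin n => (fun r => G r j) = (fun r => G r i))).card)
        (Finset.mem_univ i)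
    · push Not at h
      simp [h]
  have hKi : ∀ i, a i ≠ 0 → 2 * K + 2 ≤ ∑ w, min (bmul a w) (bmul a (w + a i)) := by
    intro i hi
    have hp0 : 0 < p := by
      refine lt_of_lt_of_le ?_ (hple (a i))
      exact Finset.card_pos.2 ⟨i, by simp⟩
    obtain ⟨F, hF, hy⟩ := hdens i
    have h1 := aux_count σ a i hi F hF (by
      intro y hyF
      obtain ⟨hd, h3, h4⟩ := hy y hyF
      refine ⟨?_, h3, h4⟩
      ext r
      have hr : G r ∈ C := by rw [← hG]; exact Submodule.subset_span ⟨r, rfl⟩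
      have := hd (G r) hr
      simp only [Finset.sum_apply, Pi.smul_apply, smul_eq_mul, Pi.zero_apply]
      rw [← this]
      exact Finset.sum_congr rfl fun j _ => mul_comm _ _)
    rw [aux_pairs hV a i] at h1
    rw [aux_min hV a i hi]
    set c : (Fin m → ZMod 2) → ℕ := fun w =>
      (Finset.univ.filter (fun j => j ≠ i ∧ a j = w)).card with hc
    have hcp : ∀ w, c w ≤ p := fun w =>
      (Finset.card_le_card (fun j hj => by simp at hj ⊢; exact hj.2)).trans (hple w)
    have h2 : ∑ w, c w * c (w + a i) ≤ p * ∑ w, min (c w) (c (w + a i)) := by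
      rw [Finset.mul_sum]
      refine Finset.sum_le_sum fun w _ => ?_
      rcases le_total (c w) (c (w + a i)) with h | h
      · rw [min_eq_left h, mul_comm]
        exact Nat.mul_le_mul_right _ (hcp _)
      · rw [min_eq_right h]
        exact Nat.mul_le_mul_right _ (hcp _)
    obtain ⟨t, ht⟩ := aux_even hV (a i) hi c
    have h3 : 2 * σ ≤ p * (t + t) := by
      rw [← ht]; exact h1.trans h2
    have h4 : K ≤ t := by
      rw [hK]
      apply Nat.le_of_lt_succ
      rw [Nat.div_lt_iff_lt_mul hp0]
      have : σ ≤ p * t := by nlinarith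
      have h5 : (t + 1) * p = p * t + p := by ring
      rw [Nat.succ_eq_add_one, h5]
      omega
    have h6 : 2 * K + 2 ≤ (∑ w, min (c w) (c (w + a i))) + 2 := by omega
    exact h6
  apply aux_final
  let A : Matrix (Fin m) (Fin n) (ZMod 2) := Matrix.of G
  have hrank : Module.finrank (ZMod 2) C = Module.finrank (ZMod 2) (LinearMap.range A.mulVecLin) := by
    rw [← hG]
    exact (Matrix.rank_eq_finrank_span_row A).symm
  rw [hrank]
  have hcard : Nat.card (LinearMap.range A.mulVecLin) =
      2 ^ Module.finrank (ZMod 2) (LinearMap.range A.mulVecLin) := by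
    rw [Module.natCard_eq_pow_finrank (K := ZMod 2)]
    simp
  rw [← hcard]
  have hex : ∀ u : LinearMap.range A.mulVecLin, ∃ T : Finset (Fin n),
      ∑ j ∈ T, a j = (u : Fin m → ZMod 2) ∧ T.card * (K + 1) ≤ n := by
    rintro ⟨u, y, rfl⟩
    obtain ⟨T, h1, h2⟩ := aux_radius hV a K hKi (Finset.univ.filter (fun j => y j ≠ 0))
    refine ⟨T, ?_, h2⟩
    rw [h1, Finset.sum_filter]
    ext r
    simp only [Finset.sum_apply, Matrix.mulVecLin_apply, Matrix.mulVec, dotProduct]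
    refine Finset.sum_congr rfl fun j _ => ?_
    by_cases hj : y j = 0
    · simp [hj]
    · simp [hone _ hj, a, A]
  choose t ht1 ht2 using hex
  have hinj : Function.Injective
      (fun u => (⟨t u, by simpa using ht2 u⟩ : {T // T ∈ ((Finset.univ : Finset (Finset (Fin n))).filter
        (fun T => T.card * (K + 1) ≤ n))})) := by
    intro u u' h
    have h' : t u = t u' := congrArg Subtype.val h
    apply Subtype.ext
    rw [← ht1 u, ← ht1 u', h']
  have := Nat.card_le_card_of_injective _ hinj
  exact this.trans (by rw [Nat.card_eq_fintype_card, Fintype.card_coe])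
end

section
/- Let G be an m×n matrix over F₂ with columns v₁,…,vₙ, let V ⊆ F₂ⁿ be the span of the rows of G, and let p = maxᵢ #{j : vⱼ = vᵢ} be the maximal multiplicity of a column of G. Let σ > p be an integer and suppose that for every coordinate i ∈ {1,…,n} the dual V^⊥ contains at least σ vectors of Hamming weight 3 whose support contains i. Then for every index i with vᵢ ≠ 0 there exist at least ⌈σ/p⌉ pairwise disjoint two-element sets {r,s} ⊆ {1,…,n}∖{i} with vᵢ = v_r + v_s. -/
/-- If each coordinate lies in the support of at least `σ` weight-3 vectors of `V^⊥`,
`p` is the maximal column multiplicity of `G`, and `σ > p`, then every nonzero column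
of `G` has at least `⌈σ/p⌉` pairwise disjoint representations as a sum of two other
columns. -/
theorem LTC_gives_disjoint_pairs
    (σ p m n : ℕ)
    (G : Fin m → Fin n → ZMod 2)
    (v : Fin n → Fin m → ZMod 2) (hv : ∀ i r, v i r = G r i)
    (V : Submodule (ZMod 2) (Fin n → ZMod 2))
    (hV : V = Submodule.span (ZMod 2) (Set.range G))
    (hp : p = Finset.univ.sup (fun i : Fin n =>
      (Finset.univ.filter (fun j : Fin n => v j = v i)).card))
    (hσp : p < σ)
    (hdens : ∀ i : Fin n, ∃ F : Finset (Fin n → ZMod 2),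
      σ ≤ F.card ∧
      ∀ y ∈ F, y ∈ dualSet (V : Set (Fin n → ZMod 2)) ∧ hammingNorm y = 3 ∧ y i ≠ 0) :
    ∀ i : Fin n, v i ≠ 0 →
      ∃ P : Finset (Finset (Fin n)),
        (σ + p - 1) / p ≤ P.card ∧
        (P : Set (Finset (Fin n))).PairwiseDisjoint id ∧
        ∀ s ∈ P, ∃ r s' : Fin n, r ≠ s' ∧ s = {r, s'} ∧ i ∉ s ∧ v i = v r + v s' := by
  classical
  intro i _
  obtain ⟨F, hFc, hF⟩ := hdens i
  have hcls : ∀ j : Fin n, (Finset.univ.filter (fun k : Fin n => v k = v j)).card ≤ p := by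
    intro j
    rw [hp]
    exact Finset.le_sup (f := fun i : Fin n =>
      (Finset.univ.filter (fun j : Fin n => v j = v i)).card) (Finset.mem_univ j)
  -- rank of an index inside its class of equal columns
  let ρ : Fin n → ℕ := fun j => (Finset.univ.filter (fun k : Fin n => v k = v j ∧ k < j)).card
  have hρlt : ∀ j, ρ j < p := by
    intro j
    refine lt_of_lt_of_le (Finset.card_lt_card ?_) (hcls j)
    rw [Finset.ssubset_iff_of_subset]
    · exact ⟨j, by simp, by simp⟩
    · intro k hk
      simp only [Finset.mem_filter, Finset.mem_univ, true_and] at hk ⊢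
      exact hk.1
  have hρmono : ∀ j k, v j = v k → j < k → ρ j < ρ k := by
    intro j k hjk hlt
    apply Finset.card_lt_card
    rw [Finset.ssubset_iff_of_subset]
    · exact ⟨j, by simp [hjk, hlt], by simp⟩
    · intro l hl
      simp only [Finset.mem_filter, Finset.mem_univ, true_and] at hl ⊢
      exact ⟨hl.1.trans hjk, hl.2.trans hlt⟩
  have hρinj : ∀ j k, v j = v k → ρ j = ρ k → j = k := by
    intro j k hjk he
    rcases lt_trichotomy j k with h | h | h
    · have := hρmono j k hjk h
      omega
    · exact h
    · have := hρmono k j hjk.symm h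
      omega
  have hppos : 0 < p := lt_of_le_of_lt (Nat.zero_le _) (hρlt i)
  have z2 : ∀ a : ZMod 2, a ≠ 0 → a = 1 := by decide
  have z3 : ∀ a b c : ZMod 2, a + (b + c) = 0 → a = b + c := by decide
  let S : (Fin n → ZMod 2) → Finset (Fin n) :=
    fun y => (Finset.univ.filter (fun j => y j ≠ 0)).erase i
  have hSinj : Set.InjOn S (F : Set (Fin n → ZMod 2)) := by
    intro y hy z hz hyz
    have h1 := (hF y hy).2.2
    have h2 := (hF z hz).2.2
    funext j
    by_cases hj : j = i
    · subst hj
      rw [z2 _ h1, z2 _ h2]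
    · have h3 : j ∈ S y ↔ j ∈ S z := by rw [hyz]
      simp only [S, Finset.mem_erase, Finset.mem_filter, Finset.mem_univ, true_and, hj,
        not_false_eq_true, ne_eq] at h3
      by_cases h4 : y j = 0
      · have : z j = 0 := by
          by_contra h5
          exact (h3.2 h5) h4
        rw [h4, this]
      · rw [z2 _ h4, z2 _ (h3.1 h4)]
  have hSpair : ∀ s ∈ F.image S,
      ∃ r s' : Fin n, r ≠ s' ∧ s = {r, s'} ∧ i ∉ s ∧ v i = v r + v s' := by
    intro s hs
    obtain ⟨y, hy, rfl⟩ := Finset.mem_image.1 hs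
    obtain ⟨hd, h3, hi⟩ := hF y hy
    have hmem : i ∈ Finset.univ.filter (fun j => y j ≠ 0) := by simp [hi]
    have hcard : (S y).card = 2 := by
      have : (Finset.univ.filter (fun j => y j ≠ 0)).card = 3 := h3
      simp only [S]
      rw [Finset.card_erase_of_mem hmem, this]
    obtain ⟨r, s', hne, he⟩ := Finset.card_eq_two.1 hcard
    refine ⟨r, s', hne, he, by simp [S], ?_⟩
    funext t
    have h0 : ∑ j, G t j * y j = 0 := by
      apply hd
      rw [hV]
      exact Submodule.subset_span ⟨t, rfl⟩
    have h1 : ∑ j, G t j * y j = ∑ j ∈ Finset.univ.filter (fun j => y j ≠ 0), G t j := by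
      rw [Finset.sum_filter]
      apply Finset.sum_congr rfl
      intro j _
      by_cases h : y j = 0
      · simp [h]
      · rw [if_pos h, z2 _ h, mul_one]
    rw [h1, ← Finset.add_sum_erase _ _ hmem] at h0
    change G t i + ∑ j ∈ S y, G t j = 0 at h0
    rw [he, Finset.sum_pair hne] at h0
    rw [Pi.add_apply, hv, hv, hv]
    exact z3 _ _ _ h0
  let c : Finset (Fin n) → ℕ := fun e => (∑ j ∈ e, ρ j) % p
  have hpig : ∃ k ∈ Finset.range p, (σ - 1) / p < ((F.image S).filter (fun e => c e = k)).card := by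
    apply Finset.exists_lt_card_fiber_of_mul_lt_card_of_maps_to
    · intro e _
      exact Finset.mem_range.2 (Nat.mod_lt _ hppos)
    · rw [Finset.card_range, Finset.card_image_of_injOn hSinj]
      have := Nat.mul_div_le (σ - 1) p
      omega
  obtain ⟨k, _, hk⟩ := hpig
  refine ⟨(F.image S).filter (fun e => c e = k), ?_, ?_, ?_⟩
  · have : σ + p - 1 = (σ - 1) + p := by omega
    rw [this, Nat.add_div_right _ hppos]
    exact hk
  · -- two edges of the same colour sharing a vertex coincide
    have key : ∀ x a b : Fin n, x ≠ a → x ≠ b → v i = v x + v a → v i = v x + v b →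
        c {x, a} = c {x, b} → a = b := by
      intro x a b hxa hxb h1 h2 h3
      apply hρinj
      · exact add_left_cancel (h1.symm.trans h2)
      · simp only [c] at h3
        rw [Finset.sum_pair hxa, Finset.sum_pair hxb] at h3
        have h4 : ρ a ≡ ρ b [MOD p] := Nat.ModEq.add_left_cancel' (ρ x) h3
        exact Nat.ModEq.eq_of_lt_of_lt h4 (hρlt a) (hρlt b)
    have form : ∀ e ∈ F.image S, ∀ x ∈ e, ∃ a, x ≠ a ∧ e = {x, a} ∧ v i = v x + v a := by
      intro e he x hx
      obtain ⟨r, s', hne, h1, _, h2⟩ := hSpair e he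
      rw [h1, Finset.mem_insert, Finset.mem_singleton] at hx
      rcases hx with rfl | rfl
      · exact ⟨s', hne, h1, h2⟩
      · exact ⟨r, hne.symm, by rw [h1, Finset.pair_comm], by rw [h2, add_comm]⟩
    intro e he f hf hef
    rw [Finset.mem_coe, Finset.mem_filter] at he hf
    change Disjoint e f
    rw [Finset.disjoint_left]
    intro x hxe hxf
    obtain ⟨a, ha, hea, hva⟩ := form e he.1 x hxe
    obtain ⟨b, hb, hfb, hvb⟩ := form f hf.1 x hxf
    apply hef
    have := key x a b ha hb hva hvb (by rw [← hea, ← hfb, he.2, hf.2])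
    rw [hea, hfb, this]
  · intro s hs
    exact hSpair s (Finset.mem_filter.1 hs).1
end
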